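/- arXiv:1205.2905 — 4 statements merged into one kernel-verified Lean document; each statement's English description precedes it below -/
import Mathlib

section
/- The squarefree flow (X, σ) possesses a unique measure of maximal entropy; that is, there is exactly one shift-invariant Borel probability measure μ on X whose measure-theoretic entropy equals the topological entropy of (X, σ). -/
open MeasureTheory Filter Set
open scoped ENNReal Classical

noncomputable section

/-- The sequence space `{0,1}^{ℕ*}`; index `n : ℕ` represents the positive integer `n + 1`. -/
abbrev Omega2 : Type := ℕ → Bool

/-- The left shift `(σ x)_n = x_{n+1}`. -/
def shift : Omega2 → Omega2 := fun x n => x (n + 1)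

/-- `x` omits the residue class `a` modulo `q` (the position of index `n` is `n + 1`). -/
def OmitsMod (x : Omega2) (q : ℕ) (a : ZMod q) : Prop :=
  ∀ n : ℕ, ((n + 1 : ℕ) : ZMod q) = a → x n = false

/-- The squarefree flow: sequences whose support omits at least one residue class
modulo `p ^ 2` for every prime `p`. -/
def SqfFlow : Set Omega2 :=
  {x | ∀ p : Nat.Primes, ∃ a : ZMod ((p : ℕ) ^ 2), OmitsMod x ((p : ℕ) ^ 2) a}

instance (p : Nat.Primes) : NeZero ((p : ℕ) ^ 2) := ⟨pow_ne_zero 2 p.2.ne_zero⟩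
instance (n : ℕ) : MeasurableSpace (ZMod n) := ⊤
instance (n : ℕ) : TopologicalSpace (ZMod n) := ⊥
instance (n : ℕ) : DiscreteTopology (ZMod n) := ⟨rfl⟩

/-- The group `G = ∏_p ℤ/p²ℤ`. -/
abbrev G : Type := ∀ p : Nat.Primes, ZMod ((p : ℕ) ^ 2)

/-- Translation by `(-1, -1, -1, …)` on `G`. -/
def T1 : G → G := fun g p => g p - 1

/-- `G₁ = {g : g_p ≡ 1 mod p² for some prime p}`. -/
def G1 : Set G := {g | ∃ p : Nat.Primes, g p = 1}

/-- Shannon entropy of the finite partition of `α` induced by `f`. -/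
def partH {α β : Type*} [MeasurableSpace α] [Fintype β] (μ : Measure α) (f : α → β) : ℝ :=
  ∑ b : β, Real.negMulLog ((μ (f ⁻¹' {b})).toReal)

/-- Entropy of the process generated by the observable `f` under `T`. -/
def procH {α : Type*} [MeasurableSpace α] (μ : Measure α) (T : α → α)
    {k : ℕ} (f : α → Fin k) : ℝ :=
  ⨅ n : ℕ, partH μ (fun x (i : Fin (n + 1)) => f (T^[(i : ℕ)] x)) / (n + 1)

/-- Kolmogorov–Sinai entropy of `T` with respect to `μ`: supremum over finite measurable
partitions (encoded as finite-valued measurable observables). -/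
def ksEntropy {α : Type*} [MeasurableSpace α] (μ : Measure α) (T : α → α) : EReal :=
  ⨆ (k : ℕ) (f : α → Fin k) (_ : Measurable f), ((procH μ T f : ℝ) : EReal)

/-- First return time (`0` if the point never returns). -/
def retTime {α : Type*} (T : α → α) (Y : Set α) (x : α) : ℕ :=
  sInf {n : ℕ | 0 < n ∧ T^[n] x ∈ Y}

/-- Induced (first–return) transformation, as a map of the ambient space. -/
def inducedAmb {α : Type*} (T : α → α) (Y : Set α) (x : α) : α :=
  T^[retTime T Y x] x

/-- Number of omitted residue classes modulo `q`. -/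
def numOmitted (x : Omega2) (q : ℕ) : ℕ := Set.ncard {a : ZMod q | OmitsMod x q a}

/-- `x` is persistent modulo `q`: every residue class meeting the support meets it infinitely. -/
def Persistent (x : Omega2) (q : ℕ) : Prop :=
  ∀ a : ZMod q, (∃ n : ℕ, ((n + 1 : ℕ) : ZMod q) = a ∧ x n = true) →
    {n : ℕ | ((n + 1 : ℕ) : ZMod q) = a ∧ x n = true}.Infinite

/-- The set of `p`-persistent sequences in the squarefree flow. -/
def SP (p : Nat.Primes) : Set Omega2 := {x ∈ SqfFlow | Persistent x ((p : ℕ) ^ 2)}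

/-- `X_I`: sequences omitting exactly `I p` classes mod `p²` and persistent for every `p`. -/
def XI (I : Nat.Primes → ℕ) : Set Omega2 :=
  {x ∈ SqfFlow | (∀ p : Nat.Primes, numOmitted x ((p : ℕ) ^ 2) = I p) ∧
    ∀ p : Nat.Primes, Persistent x ((p : ℕ) ^ 2)}

/-- `X₁ = X_{(1,1,1,…)}`. -/
def X1 : Set Omega2 := XI fun _ => 1

/-- `ρ(x)_p` is the (unique, for `x ∈ X₁`) omitted residue class mod `p²`. -/
def rho (x : Omega2) : G := fun p =>
  if h : ∃ a : ZMod ((p : ℕ) ^ 2), OmitsMod x ((p : ℕ) ^ 2) a then h.choose else 0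

/-- `Y = ρ⁻¹(G₁ᶜ) ⊆ X₁`. -/
def Y : Set Omega2 := {x ∈ X1 | rho x ∈ G1ᶜ}

/-- `α_g(m) = #{1 ≤ n ≤ m : n ≡ g_p mod p² for some prime p}`. -/
def alphaG (g : G) (m : ℕ) : ℕ :=
  Set.ncard {n : ℕ | 1 ≤ n ∧ n ≤ m ∧ ∃ p : Nat.Primes, ((n : ℕ) : ZMod ((p : ℕ) ^ 2)) = g p}

/-- The insertion map `ι : G × Ω⁽²⁾ → X`; position of index `n` is `m = n + 1`, and the
`1`-based value `y_{m - α_g(m)}` is the `0`-based entry `y (n - α_g(n+1))`. -/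
def iota (g : G) (y : Omega2) : Omega2 := fun n =>
  if ∃ p : Nat.Primes, ((n + 1 : ℕ) : ZMod ((p : ℕ) ^ 2)) = g p then false
  else y (n - alphaG g (n + 1))

/-- The skew product `T(g,y) = (T₁ g, σ^{ψ(g)} y)`, `ψ = 1 - 1_{G₁}`. -/
def skewT : G × Omega2 → G × Omega2 := fun gy =>
  if gy.1 ∈ G1 then (T1 gy.1, gy.2) else (T1 gy.1, shift gy.2)

/-- `G₁ᶜ × Ω⁽²⁾` as a subset of `G × Ω⁽²⁾`. -/
def ZSet : Set (G × Omega2) := G1ᶜ ×ˢ (Set.univ : Set Omega2)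

/-- `x̂`: delete from `x` the entries at positions congruent to `(g_x)_p` mod `p²` for some `p`. -/
def hat (x : Omega2) : Omega2 := fun m =>
  x (Nat.nth (fun j => ¬ ∃ p : Nat.Primes, ((j + 1 : ℕ) : ZMod ((p : ℕ) ^ 2)) = rho x p) m)

/-- A Haar probability measure on `G`: a translation-invariant Borel probability measure. -/
def IsHaarLike (m : Measure G) : Prop :=
  IsProbabilityMeasure m ∧ ∀ g : G, MeasurePreserving (fun h => g + h) m m

/-- The `(1/2, 1/2)` Bernoulli measure on `Ω⁽²⁾`, characterized by its cylinder values. -/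
def IsBernoulliHalf (ω : Measure Omega2) : Prop :=
  IsProbabilityMeasure ω ∧
    ∀ (s : Finset ℕ) (v : ℕ → Bool), ω {x | ∀ i ∈ s, x i = v i} = (1 / 2 : ℝ≥0∞) ^ s.card

/-- Normalized restriction of a measure on `G` to `G₁ᶜ`. -/
def mbar (m : Measure G) : Measure G := (m G1ᶜ)⁻¹ • m.restrict G1ᶜ

/-- The `k`-th prime (`0`-indexed), as an element of `Nat.Primes`. -/
def nthPrime (k : ℕ) : Nat.Primes := ⟨Nat.nth Nat.Prime k, Nat.prime_nth_prime k⟩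

/-- `X(r)`: sequences omitting at least one class mod `p_i²` for the first `r` primes. -/
def Xr (r : ℕ) : Set Omega2 :=
  {x | ∀ k : Fin r, ∃ a : ZMod ((nthPrime k : ℕ) ^ 2), OmitsMod x ((nthPrime k : ℕ) ^ 2) a}

/-- `X_I(r)`: elements of `X(r)` omitting exactly `I k` classes mod `p_k²` for `k ≤ r`. -/
def XIr (r : ℕ) (I : Fin r → ℕ) : Set Omega2 :=
  {x ∈ Xr r | ∀ k : Fin r, numOmitted x ((nthPrime k : ℕ) ^ 2) = I k}

/-- Number of distinct words of length `L` occurring in elements of `F`. -/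
def wordCount (F : Set Omega2) (L : ℕ) : ℕ :=
  Set.ncard {w : Fin L → Bool | ∃ x ∈ F, ∃ j : ℕ, ∀ t : Fin L, w t = x (j + (t : ℕ))}

/-- `α_g^r(m)`, counting only the first `r` primes. -/
def alphaGr (r : ℕ) (g : G) (m : ℕ) : ℕ :=
  Set.ncard {n : ℕ | 1 ≤ n ∧ n ≤ m ∧
    ∃ k : Fin r, ((n : ℕ) : ZMod ((nthPrime k : ℕ) ^ 2)) = g (nthPrime k)}

/-- The partial insertion map `ι_r`. -/
def iotaR (r : ℕ) (g : G) (y : Omega2) : Omega2 := fun n =>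
  if ∃ k : Fin r, ((n + 1 : ℕ) : ZMod ((nthPrime k : ℕ) ^ 2)) = g (nthPrime k) then false
  else y (n - alphaGr r g (n + 1))

/-- The initial word of length `n`. -/
def word (n : ℕ) (x : Omega2) : Fin n → Bool := fun i => x i

section PartitionEntropy

variable {α β γ : Type*} [MeasurableSpace α] [Fintype β] [MeasurableSpace β]
  [MeasurableSingletonClass β] [Fintype γ] [MeasurableSpace γ] [MeasurableSingletonClass γ]

lemma integrable_comp_of_finite (μ : Measure α) [IsFiniteMeasure μ] {A : α → β}
    (hA : Measurable A) (ψ : β → ℝ) : Integrable (fun x => ψ (A x)) μ := by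
  have : Integrable ψ (μ.map A) := Integrable.of_finite
  exact this.comp_measurable hA

lemma integral_comp_of_finite (μ : Measure α) [IsFiniteMeasure μ] {A : α → β}
    (hA : Measurable A) (ψ : β → ℝ) :
    ∫ x, ψ (A x) ∂μ = ∑ b, μ.real (A ⁻¹' {b}) * ψ b := by
  have h : Integrable ψ (μ.map A) := Integrable.of_finite
  rw [← integral_map hA.aemeasurable h.aestronglyMeasurable, integral_fintype h]
  refine Finset.sum_congr rfl fun b _ => ?_
  rw [map_measureReal_apply hA (measurableSet_singleton b), smul_eq_mul]

lemma partH_eq_integral (μ : Measure α) [IsFiniteMeasure μ] {A : α → β} (hA : Measurable A) :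
    partH μ A = ∫ x, -Real.log (μ.real (A ⁻¹' {A x})) ∂μ := by
  rw [integral_comp_of_finite μ hA fun b => -Real.log (μ.real (A ⁻¹' {b}))]
  refine Finset.sum_congr rfl fun b _ => ?_
  simp [Real.negMulLog, Measure.real]

lemma partH_nonneg {β : Type*} [Fintype β] (μ : Measure α) [IsProbabilityMeasure μ] (A : α → β) :
    0 ≤ partH μ A :=
  Finset.sum_nonneg fun _ _ => Real.negMulLog_nonneg ENNReal.toReal_nonneg
    measureReal_le_one

lemma ae_pos_measureReal_fiber {α β : Type*} [MeasurableSpace α] [Fintype β] (μ : Measure α)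
    [IsFiniteMeasure μ] (A : α → β) : ∀ᵐ x ∂μ, 0 < μ.real (A ⁻¹' {A x}) := by
  have : ∀ᵐ x ∂μ, ∀ b, μ.real (A ⁻¹' {b}) = 0 → A x ≠ b := by
    rw [ae_all_iff]
    intro b
    by_cases hb : μ.real (A ⁻¹' {b}) = 0
    · have : μ (A ⁻¹' {b}) = 0 := (measureReal_eq_zero_iff (by finiteness)).1 hb
      filter_upwards [compl_mem_ae_iff.2 this] with x hx _ h
      exact hx h
    · exact Eventually.of_forall fun x h => absurd h hb
  filter_upwards [this] with x hx
  exact lt_of_le_of_ne measureReal_nonneg fun h => hx _ h.symm rfl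

/-- Gibbs' inequality for the distribution of a finite-valued observable. -/
lemma partH_le_log_sub_integral (μ : Measure α) [IsProbabilityMeasure μ] {A : α → β}
    (hA : Measurable A) {q : β → ℝ} {Z : ℝ} (hq : ∀ b, 0 ≤ q b) (hZ : ∑ b, q b ≤ Z)
    (hZ0 : 0 < Z) (hpos : ∀ᵐ x ∂μ, 0 < q (A x)) :
    partH μ A ≤ Real.log Z - ∫ x, Real.log (q (A x)) ∂μ := by
  have key : ∀ b, Real.negMulLog (μ.real (A ⁻¹' {b})) ≤
      μ.real (A ⁻¹' {b}) * (Real.log Z - Real.log (q b)) + (q b / Z - μ.real (A ⁻¹' {b})) := by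
    intro b
    rcases eq_or_lt_of_le (measureReal_nonneg (μ := μ) (s := A ⁻¹' {b})) with h0 | h0
    · rw [← h0]
      simpa using div_nonneg (hq b) hZ0.le
    · have hqb : 0 < q b := by
        by_contra hcon
        have : μ (A ⁻¹' {b}) = 0 := by
          refine measure_mono_null ?_ (ae_iff.1 hpos)
          intro x hx
          have hx' : A x = b := hx
          simpa [hx'] using hcon
        simp [Measure.real, this] at h0
      have := Real.log_le_sub_one_of_pos (div_pos (div_pos hqb hZ0) h0)
      rw [Real.log_div (div_pos hqb hZ0).ne' h0.ne', Real.log_div hqb.ne' hZ0.ne'] at this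
      have h2 := mul_le_mul_of_nonneg_left this h0.le
      have h3 : μ.real (A ⁻¹' {b}) * (q b / Z / μ.real (A ⁻¹' {b}) - 1)
        = q b / Z - μ.real (A ⁻¹' {b}) := by field_simp
      rw [h3] at h2
      simp only [Real.negMulLog]
      linarith
  have hsum : ∑ b, μ.real (A ⁻¹' {b}) = 1 := by
    have := integral_comp_of_finite μ hA fun _ => (1 : ℝ)
    simpa using this.symm
  have hI : ∫ x, (Real.log Z - Real.log (q (A x))) ∂μ = Real.log Z - ∫ x, Real.log (q (A x)) ∂μ := by
    rw [integral_sub (integrable_const _)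
      (integrable_comp_of_finite μ hA fun b => Real.log (q b))]
    simp
  rw [← hI, integral_comp_of_finite μ hA fun b => Real.log Z - Real.log (q b)]
  calc partH μ A ≤ ∑ b, (μ.real (A ⁻¹' {b}) * (Real.log Z - Real.log (q b))
        + (q b / Z - μ.real (A ⁻¹' {b}))) := Finset.sum_le_sum fun b _ => key b
    _ ≤ _ := by
      rw [Finset.sum_add_distrib, Finset.sum_sub_distrib, hsum, ← Finset.sum_div]
      have : (∑ b, q b) / Z ≤ 1 := (div_le_one hZ0).2 hZ
      linarith

lemma partH_le_log_card (μ : Measure α) [IsProbabilityMeasure μ] {A : α → β}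
    (hA : Measurable A) {S : Finset β} (hS : ∀ᵐ x ∂μ, A x ∈ S) :
    partH μ A ≤ Real.log S.card := by
  have hne : S.Nonempty := by
    obtain ⟨x, hx⟩ := hS.exists
    exact ⟨_, hx⟩
  have h := partH_le_log_sub_integral μ hA (q := fun b => if b ∈ S then 1 else 0) (Z := S.card)
    (fun b => by split_ifs <;> norm_num) (by simp) (by exact_mod_cast hne.card_pos)
    (by filter_upwards [hS] with x hx; simp [hx])
  refine h.trans (le_of_eq ?_)
  rw [integral_eq_zero_of_ae, sub_zero]
  filter_upwards [hS] with x hx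
  simp [hx]

lemma partH_le_partH_prodMk (μ : Measure α) [IsProbabilityMeasure μ] {A : α → β} {B : α → γ}
    (hA : Measurable A) (hB : Measurable B) :
    partH μ A ≤ partH μ fun x => (A x, B x) := by
  have hAB : Measurable fun x => (A x, B x) := hA.prodMk hB
  rw [partH_eq_integral μ hA, partH_eq_integral μ hAB]
  refine integral_mono_ae
    (integrable_comp_of_finite μ hA fun b => -Real.log (μ.real (A ⁻¹' {b})))
    (integrable_comp_of_finite μ hAB fun b => -Real.log (μ.real ((fun x => (A x, B x)) ⁻¹' {b})))
    ?_
  filter_upwards [ae_pos_measureReal_fiber μ fun x => (A x, B x)] with x hx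
  refine neg_le_neg (Real.log_le_log hx (measureReal_mono ?_))
  intro y hy
  exact congrArg Prod.fst hy

lemma partH_comp_equiv {α β γ : Type*} [MeasurableSpace α] [Fintype β] [Fintype γ]
    (μ : Measure α) (A : α → β) (e : β ≃ γ) :
    partH μ (fun x => e (A x)) = partH μ A := by
  unfold partH
  rw [← e.sum_comp]
  refine Finset.sum_congr rfl fun b _ => ?_
  congr 3
  ext x
  simp

end PartitionEntropy

lemma measurable_shift : Measurable shift :=
  measurable_pi_lambda _ fun n => measurable_pi_apply (n + 1)

lemma shift_iterate (i : ℕ) (x : Omega2) (j : ℕ) : shift^[i] x j = x (i + j) := by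
  induction i generalizing x j with
  | zero => simp
  | succ i ih =>
    rw [Function.iterate_succ_apply', shift, ih]
    congr 1
    omega

lemma measurable_word (n : ℕ) : Measurable (word n) :=
  measurable_pi_lambda _ fun i => measurable_pi_apply (i : ℕ)

lemma word_preimage_mono {n m : ℕ} (h : n ≤ m) (S : Set (Fin n → Bool)) :
    word n ⁻¹' S = word m ⁻¹' {w | (fun i => w (Fin.castLE h i)) ∈ S} := rfl

/-- The algebra of sets depending on finitely many coordinates. -/
def cylAlg : Set (Set Omega2) := {C | ∃ (n : ℕ) (S : Set (Fin n → Bool)), C = word n ⁻¹' S}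

lemma isSetAlgebra_cylAlg : IsSetAlgebra cylAlg where
  empty_mem := ⟨0, ∅, by simp⟩
  compl_mem := by
    rintro _ ⟨n, S, rfl⟩
    exact ⟨n, Sᶜ, rfl⟩
  union_mem := by
    rintro _ _ ⟨n, S, rfl⟩ ⟨m, S', rfl⟩
    rw [word_preimage_mono (le_max_left n m), word_preimage_mono (le_max_right n m)]
    exact ⟨max n m, _, preimage_union.symm⟩

lemma generateFrom_cylAlg :
    (inferInstance : MeasurableSpace Omega2) = MeasurableSpace.generateFrom cylAlg := by
  apply le_antisymm
  · refine iSup_le fun i => ?_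
    rintro _ ⟨S, -, rfl⟩
    refine MeasurableSpace.measurableSet_generateFrom ⟨i + 1, {w | w (Fin.last i) ∈ S}, rfl⟩
  · refine MeasurableSpace.generateFrom_le ?_
    rintro _ ⟨n, S, rfl⟩
    exact measurable_word n (Set.toFinite S).measurableSet

lemma exists_word_approx (ν : Measure Omega2) [IsProbabilityMeasure ν] {k : ℕ}
    {f : Omega2 → Fin k} (hf : Measurable f) {ε : ℝ} (hε : 0 < ε) :
    ∃ (L : ℕ) (f' : (Fin L → Bool) → Fin k), ν.real {x | f x ≠ f' (word L x)} ≤ ε := by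
  have hk : 0 < k := (Nat.zero_le _).trans_lt (f fun _ => false).2
  have hd := Measure.MeasureDense.of_generateFrom_isSetAlgebra_finite (μ := ν)
    isSetAlgebra_cylAlg generateFrom_cylAlg
  have hap : ∀ b : Fin k, ∃ (n : ℕ) (S : Set (Fin n → Bool)),
      ν.real (symmDiff (f ⁻¹' {b}) (word n ⁻¹' S)) ≤ ε / k := by
    intro b
    obtain ⟨_, ⟨n, S, rfl⟩, h⟩ := hd.approx _ (hf (measurableSet_singleton b))
      (measure_ne_top _ _) (ε / k) (by positivity)
    exact ⟨n, S, ENNReal.toReal_le_of_le_ofReal (by positivity) h.le⟩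
  choose n S hS using hap
  let L := Finset.univ.sup n
  have hn : ∀ b, n b ≤ L := fun b => Finset.le_sup (Finset.mem_univ b)
  let S' : Fin k → Set (Fin L → Bool) := fun b => {w | (fun i => w (Fin.castLE (hn b) i)) ∈ S b}
  refine ⟨L, fun w => if h : ∃ b, w ∈ S' b then h.choose else ⟨0, hk⟩, ?_⟩
  have hsub : {x | f x ≠ if h : ∃ b, word L x ∈ S' b then h.choose else ⟨0, hk⟩} ⊆
      ⋃ b, symmDiff (f ⁻¹' {b}) (word (n b) ⁻¹' S b) := by
    intro x hx
    by_contra hcon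
    simp only [mem_iUnion, not_exists] at hcon
    have hiff : ∀ b, f x = b ↔ word L x ∈ S' b := by
      intro b
      have h1 := hcon b
      rw [Set.mem_symmDiff] at h1
      change ¬ ((f x = b ∧ ¬ word L x ∈ S' b) ∨ (word L x ∈ S' b ∧ ¬ f x = b)) at h1
      tauto
    have hex : ∃ b, word L x ∈ S' b := ⟨f x, (hiff _).1 rfl⟩
    apply hx
    rw [dif_pos hex]
    exact (hiff _).2 hex.choose_spec
  refine (measureReal_mono hsub).trans ((measureReal_iUnion_fintype_le _).trans ?_)
  refine (Finset.sum_le_sum fun b _ => hS b).trans (le_of_eq ?_)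
  have : (k : ℝ) ≠ 0 := by positivity
  simp
  field_simp

lemma partH_itinerary_le (ν : Measure Omega2) [IsProbabilityMeasure ν]
    (hν : MeasurePreserving shift ν ν) {k : ℕ} {f : Omega2 → Fin k} (hf : Measurable f)
    {δ : ℝ} (hδ : 0 < δ) :
    ∃ L : ℕ, ∀ n : ℕ, partH ν (fun x (i : Fin n) => f (shift^[(i : ℕ)] x)) ≤
      partH ν (word (n + L)) + n * δ := by
  have hk : 0 < k := (Nat.zero_le _).trans_lt (f fun _ => false).2
  have hk1 : (1 : ℝ) ≤ k := by exact_mod_cast hk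
  set a : ℝ := Real.exp (-(δ / 2)) with ha
  have ha0 : 0 < a := Real.exp_pos _
  have ha1 : a < 1 := by rw [ha, Real.exp_lt_one_iff]; linarith
  set e : ℝ := (1 - a) / k with he
  have he0 : 0 < e := div_pos (by linarith) (by linarith)
  set M : ℝ := |Real.log e| with hM
  have hM0 : 0 ≤ M := abs_nonneg _
  obtain ⟨L, f', hf'⟩ := exists_word_approx ν hf (ε := δ / 2 / (M + 1)) (by positivity)
  refine ⟨L, fun n => ?_⟩
  let κ : Fin k → (Fin L → Bool) → ℝ := fun b v => if b = f' v then a else e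
  have hκ0 : ∀ b v, 0 < κ b v := fun b v => by dsimp only [κ]; split_ifs <;> assumption
  have hκsum : ∀ v, ∑ b, κ b v ≤ 1 := by
    intro v
    have : ∀ b, κ b v ≤ (if b = f' v then a else 0) + e := fun b => by
      dsimp only [κ]; split_ifs <;> linarith
    refine (Finset.sum_le_sum fun b _ => this b).trans (le_of_eq ?_)
    have : (k : ℝ) ≠ 0 := by positivity
    rw [Finset.sum_add_distrib]
    simp [he]
    field_simp
    ring
  let g : Omega2 → ℝ := fun x => Real.log (κ (f x) (word L x))
  have hfw : Measurable fun x => (f x, word L x) := hf.prodMk (measurable_word L)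
  have hgint : Integrable g ν :=
    integrable_comp_of_finite ν hfw fun y : Fin k × (Fin L → Bool) => Real.log (κ y.1 y.2)
  have hbad : MeasurableSet {x | f x ≠ f' (word L x)} :=
    (measurableSet_eq_fun hf ((measurable_of_finite f').comp (measurable_word L))).compl
  have hg : -δ ≤ ∫ x, g x ∂ν := by
    have h1 : ∀ x, -(δ / 2) - {x | f x ≠ f' (word L x)}.indicator (fun _ => M) x ≤ g x := by
      intro x
      by_cases hx : f x = f' (word L x)
      · simp [g, κ, hx, ha]
      · have : x ∈ {x | f x ≠ f' (word L x)} := hx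
        rw [indicator_of_mem this]
        simp only [g, κ, if_neg hx]
        have := neg_abs_le (Real.log e)
        linarith
    have h2 : ∫ x, (-(δ / 2) - {x | f x ≠ f' (word L x)}.indicator (fun _ => M) x) ∂ν
        ≤ ∫ x, g x ∂ν :=
      integral_mono ((integrable_const _).sub ((integrable_const M).indicator hbad)) hgint h1
    rw [integral_sub (integrable_const _) ((integrable_const M).indicator hbad),
      integral_indicator_const _ hbad] at h2
    simp only [integral_const, probReal_univ, smul_eq_mul, one_mul] at h2
    have h3 : ν.real {x | f x ≠ f' (word L x)} * M ≤ δ / 2 := by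
      refine (mul_le_mul_of_nonneg_right hf' hM0).trans ?_
      rw [div_mul_eq_mul_div, div_le_iff₀ (by positivity)]
      nlinarith
    linarith
  let F : Omega2 → Fin n → Fin k := fun x i => f (shift^[(i : ℕ)] x)
  have hF : Measurable F :=
    measurable_pi_lambda _ fun i => hf.comp (measurable_shift.iterate i)
  have hW := measurable_word (n + L)
  let sub : (Fin (n + L) → Bool) → Fin n → (Fin L → Bool) :=
    fun w i j => w ⟨i + j, by omega⟩
  have hsub : ∀ x i, sub (word (n + L) x) i = word L (shift^[(i : ℕ)] x) := by
    intro x i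
    ext j
    simp [sub, word, shift_iterate]
  let p : (Fin (n + L) → Bool) → ℝ := fun w => ν.real (word (n + L) ⁻¹' {w})
  have hpsum : ∑ w, p w = 1 := by
    have := integral_comp_of_finite ν hW fun _ => (1 : ℝ)
    simpa using this.symm
  let q : (Fin n → Fin k) × (Fin (n + L) → Bool) → ℝ :=
    fun y => p y.2 * ∏ i, κ (y.1 i) (sub y.2 i)
  have hq0 : ∀ y, 0 ≤ q y := fun y =>
    mul_nonneg measureReal_nonneg (Finset.prod_nonneg fun i _ => (hκ0 _ _).le)
  have hqsum : ∑ y, q y ≤ 1 := by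
    rw [Fintype.sum_prod_type_right, ← hpsum]
    refine Finset.sum_le_sum fun w _ => ?_
    simp only [q]
    rw [← Finset.mul_sum]
    refine mul_le_of_le_one_right measureReal_nonneg ?_
    have : ∑ u : Fin n → Fin k, ∏ i, κ (u i) (sub w i) = ∏ i, ∑ b, κ b (sub w i) := by
      rw [Finset.prod_univ_sum, Fintype.piFinset_univ]
    rw [this]
    exact Finset.prod_le_one (fun i _ => Finset.sum_nonneg fun b _ => (hκ0 _ _).le)
      fun i _ => hκsum _
  have hpos := ae_pos_measureReal_fiber ν (word (n + L))
  refine (partH_le_partH_prodMk ν hF hW).trans ?_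
  refine (partH_le_log_sub_integral ν (hF.prodMk hW) hq0 hqsum one_pos ?_).trans ?_
  · filter_upwards [hpos] with x hx
    exact mul_pos hx (Finset.prod_pos fun i _ => hκ0 _ _)
  have hae : (fun x => Real.log (q (F x, word (n + L) x))) =ᵐ[ν]
      fun x => Real.log (p (word (n + L) x)) + ∑ i : Fin n, g (shift^[(i : ℕ)] x) := by
    filter_upwards [hpos] with x hx
    simp only [q]
    rw [Real.log_mul (ne_of_gt hx) (Finset.prod_pos fun i _ => hκ0 _ _).ne',
      Real.log_prod fun i _ => (hκ0 _ _).ne']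
    simp only [hsub]
    rfl
  have hgi : ∀ i : Fin n, Integrable (fun x => g (shift^[(i : ℕ)] x)) ν := fun i =>
    (hν.iterate i).integrable_comp_of_integrable hgint
  have hgI : ∀ i : Fin n, ∫ x, g (shift^[(i : ℕ)] x) ∂ν = ∫ x, g x ∂ν := by
    intro i
    have hm := (hν.iterate i).map_eq
    conv_rhs => rw [← hm]
    rw [integral_map (hν.iterate i).measurable.aemeasurable]
    rw [hm]
    exact hgint.aestronglyMeasurable
  rw [integral_congr_ae hae, integral_add
    (integrable_comp_of_finite ν hW fun w => Real.log (p w)) (integrable_finsetSum _ fun i _ => hgi i),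
    integral_finsetSum _ fun i _ => hgi i, Finset.sum_congr rfl fun i _ => hgI i,
    partH_eq_integral ν hW, integral_neg]
  simp only [Finset.sum_const, Finset.card_univ, Fintype.card_fin, nsmul_eq_mul, Real.log_one]
  have : (n : ℝ) * -δ ≤ n * ∫ x, g x ∂ν := mul_le_mul_of_nonneg_left hg (Nat.cast_nonneg n)
  simp only [p]
  linarith

/-- Deletion of the first `k` entries. -/
def dropN (k : ℕ) (x : Omega2) : Omega2 := fun j => x (k + j)

lemma dropN_dropN (k l : ℕ) (x : Omega2) : dropN l (dropN k x) = dropN (k + l) x := by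
  ext j
  simp [dropN, add_assoc]

/-- Extension of a finite word by zeros. -/
def extend0 {n : ℕ} (w : Fin n → Bool) : Omega2 := fun j => if h : j < n then w ⟨j, h⟩ else false

lemma extend0_word {n j : ℕ} (x : Omega2) (h : j < n) : extend0 (word n x) j = x j := by
  simp [extend0, word, h]

lemma extend0_apply {n : ℕ} (w : Fin n → Bool) (i : Fin n) : extend0 w i = w i := by
  simp [extend0]

/-- A function of sequences depending on the first `n` entries only. -/
def LocalOn (n : ℕ) (a : Omega2 → ℝ) : Prop :=
  ∀ x y : Omega2, (∀ i < n, x i = y i) → a x = a y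

/-- Sum of `a` over words of length `n`. -/
def wordSum (n : ℕ) (a : Omega2 → ℝ) : ℝ := ∑ w : Fin n → Bool, a (extend0 w)

lemma wordSum_add {n m : ℕ} {a b : Omega2 → ℝ} (ha : LocalOn n a) (hb : LocalOn m b) :
    wordSum (n + m) (fun x => a x * b (dropN n x)) = wordSum n a * wordSum m b := by
  unfold wordSum
  rw [← (Fin.appendEquiv n m).sum_comp, Fintype.sum_prod_type, Finset.sum_mul_sum]
  refine Finset.sum_congr rfl fun u _ => Finset.sum_congr rfl fun w _ => ?_
  refine congrArg₂ (· * ·) ?_ ?_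
  · refine ha _ _ fun i hi => ?_
    have := Fin.append_left u w ⟨i, hi⟩
    rw [extend0, dif_pos (by omega), extend0, dif_pos hi, ← this]
    rfl
  · refine hb _ _ fun i hi => ?_
    have := Fin.append_right u w ⟨i, hi⟩
    rw [dropN, extend0, dif_pos (by omega), extend0, dif_pos hi, ← this]
    rfl

lemma LocalOn.prod {l : ℕ} {a : ℕ → Omega2 → ℝ} (ha : ∀ i, LocalOn l (a i)) (k : ℕ) :
    LocalOn (k * l) fun x => ∏ i ∈ Finset.range k, a i (dropN (i * l) x) := by
  intro x y h
  refine Finset.prod_congr rfl fun i hi => ha i _ _ fun j hj => h _ ?_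
  have : (i + 1) * l ≤ k * l := Nat.mul_le_mul_right _ (Finset.mem_range.1 hi)
  linarith [Nat.succ_mul i l]

lemma wordSum_prod {l : ℕ} {a : ℕ → Omega2 → ℝ} (ha : ∀ i, LocalOn l (a i)) (k : ℕ) :
    wordSum (k * l) (fun x => ∏ i ∈ Finset.range k, a i (dropN (i * l) x)) =
      ∏ i ∈ Finset.range k, wordSum l (a i) := by
  induction k with
  | zero => simp [wordSum]
  | succ k ih =>
    rw [Finset.prod_range_succ, ← ih, Nat.succ_mul, ← wordSum_add (LocalOn.prod ha k) (ha k)]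
    simp only [Finset.prod_range_succ]

/-- Probability of the first `n` entries of `x` when the entries at positions in `A` are
independent fair coin tosses and the other entries vanish. -/
def wt (A : Omega2) (n : ℕ) (x : Omega2) : ℝ :=
  ∏ i ∈ Finset.range n, if A i then 1 / 2 else if x i then 0 else 1

/-- Number of elements of `A` among the first `n` positions. -/
def cnt (A : Omega2) (n : ℕ) : ℝ := ∑ i ∈ Finset.range n, if A i then 1 else 0

lemma wt_nonneg (A : Omega2) (n : ℕ) (x : Omega2) : 0 ≤ wt A n x :=
  Finset.prod_nonneg fun i _ => by split_ifs <;> norm_num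

lemma localOn_wt (A : Omega2) (n : ℕ) : LocalOn n (wt A n) := fun x y h =>
  Finset.prod_congr rfl fun i hi => by rw [h i (Finset.mem_range.1 hi)]

lemma localOn_wt_left (n : ℕ) (x : Omega2) : LocalOn n fun A => wt A n x := fun A B h =>
  Finset.prod_congr rfl fun i hi => by rw [h i (Finset.mem_range.1 hi)]

lemma wt_add (A : Omega2) (n m : ℕ) (x : Omega2) :
    wt A (n + m) x = wt A n x * wt (dropN n A) m (dropN n x) :=
  Finset.prod_range_add _ n m

lemma wt_mul (A : Omega2) (k l : ℕ) (x : Omega2) :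
    wt A (k * l) x = ∏ i ∈ Finset.range k, wt (dropN (i * l) A) l (dropN (i * l) x) := by
  induction k with
  | zero => simp [wt]
  | succ k ih => rw [Nat.succ_mul, wt_add, ih, Finset.prod_range_succ]

lemma wordSum_wt (A : Omega2) (n : ℕ) : wordSum n (wt A n) = 1 := by
  have h := wordSum_prod (l := 1) (fun i => localOn_wt (dropN i A) 1) n
  have h1 : ∀ i, wordSum 1 (wt (dropN i A) 1) = 1 := by
    intro i
    unfold wordSum
    rw [← (Equiv.funUnique (Fin 1) Bool).symm.sum_comp]
    simp only [Fintype.sum_bool, wt, Finset.prod_range_one]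
    by_cases hA : dropN i A 0 <;> simp [hA, extend0, Equiv.funUnique, uniqueElim]
    norm_num
  rw [Finset.prod_congr rfl fun i _ => h1 i, Finset.prod_const_one, mul_one] at h
  rw [← h]
  congr 1
  ext x
  have := wt_mul A n 1 x
  simpa using this

lemma wt_of_fits {A : Omega2} {n : ℕ} {x : Omega2} (h : ∀ i < n, x i = true → A i = true) :
    wt A n x = Real.exp (-(cnt A n * Real.log 2)) := by
  rw [cnt, Finset.sum_mul, ← Finset.sum_neg_distrib, Real.exp_sum]
  refine Finset.prod_congr rfl fun i hi => ?_
  by_cases hA : A i = true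
  · simp [hA, Real.exp_neg, Real.exp_log]
  · have : x i = false := by
      have := h i (Finset.mem_range.1 hi)
      simpa using mt this hA
    simp [hA, this]

lemma wt_eq_zero {A : Omega2} {n : ℕ} {x : Omega2} (h : ¬ ∀ i < n, x i = true → A i = true) :
    wt A n x = 0 := by
  push Not at h
  obtain ⟨i, hi, hx, hA⟩ := h
  exact Finset.prod_eq_zero (Finset.mem_range.2 hi) (by simp [hx, hA])

/-- Indicator of agreement with `v` on the first `L` entries. -/
def agree (v : Omega2) (L : ℕ) (x : Omega2) : ℝ := if ∀ i < L, x i = v i then 1 else 0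

lemma localOn_agree (v : Omega2) (L : ℕ) : LocalOn L (agree v L) := fun x y h => by
  have : (∀ i < L, x i = v i) ↔ ∀ i < L, y i = v i :=
    forall₂_congr fun i hi => by rw [h i hi]
  simp [agree, this]

lemma wordSum_tilted (A v : Omega2) (L : ℕ) (t : ℝ) :
    wordSum L (fun x => wt A L x * Real.exp (t * agree v L x)) =
      1 + (Real.exp t - 1) * wt A L v := by
  have h1 : ∀ x : Omega2, wt A L x * Real.exp (t * agree v L x) =
      wt A L x + (Real.exp t - 1) * (if ∀ i < L, x i = v i then wt A L v else 0) := by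
    intro x
    by_cases hx : ∀ i < L, x i = v i
    · rw [agree, if_pos hx, if_pos hx, localOn_wt A L x v hx]
      simp
      ring
    · rw [agree, if_neg hx, if_neg hx]
      simp
  have h2 : ∀ w : Fin L → Bool, (∀ i < L, extend0 w i = v i) ↔ w = word L v := by
    intro w
    constructor
    · intro h
      ext i
      rw [← extend0_apply w i, h i i.2, word]
    · rintro rfl i hi
      exact extend0_word v hi
  have := wordSum_wt A L
  unfold wordSum at this ⊢
  simp only [h1, Finset.sum_add_distrib, this, h2, ← Finset.mul_sum]
  simp

lemma wordSum_tilted_blocks_le (A v : Omega2) (L N Q : ℕ) (t : ℝ) :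
    wordSum (Q * (N * L + 1)) (fun x => wt A (Q * (N * L + 1)) x * Real.exp (t *
      ∑ s ∈ Finset.range Q, ∑ i ∈ Finset.range N,
        agree v L (dropN (s * (N * L + 1) + i * L) x))) ≤
    Real.exp ((Real.exp t - 1) * ∑ s ∈ Finset.range Q, ∑ i ∈ Finset.range N,
        wt (dropN (s * (N * L + 1) + i * L) A) L v) := by
  set K := N * L + 1 with hK
  let blk : Omega2 → Omega2 → ℝ := fun B x => wt B L x * Real.exp (t * agree v L x)
  have hblk : ∀ B, LocalOn L (blk B) := fun B x y h => by
    simp only [blk, localOn_wt B L x y h, localOn_agree v L x y h]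
  let blks : Omega2 → Omega2 → ℝ := fun B x =>
    ∏ i ∈ Finset.range N, blk (dropN (i * L) B) (dropN (i * L) x)
  have hblks : ∀ B, LocalOn (N * L) (blks B) := fun B =>
    LocalOn.prod (fun i => hblk (dropN (i * L) B)) N
  let sup : Omega2 → Omega2 → ℝ := fun B x =>
    blks B x * wt (dropN (N * L) B) 1 (dropN (N * L) x)
  have hsup : ∀ B, LocalOn K (sup B) := fun B x y h => by
    simp only [sup, hblks B x y fun i hi => h i (by omega)]
    congr 1
    exact localOn_wt _ 1 _ _ fun i hi => h _ (by omega)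
  have hsupsum : ∀ B, wordSum K (sup B) =
      ∏ i ∈ Finset.range N, (1 + (Real.exp t - 1) * wt (dropN (i * L) B) L v) := by
    intro B
    simp only [sup, K]
    rw [wordSum_add (hblks B) (localOn_wt _ 1), wordSum_wt, mul_one,
      wordSum_prod fun i => hblk (dropN (i * L) B)]
    exact Finset.prod_congr rfl fun i _ => wordSum_tilted _ _ _ _
  have hsupeq : ∀ B x, sup B x = wt B K x *
      Real.exp (t * ∑ i ∈ Finset.range N, agree v L (dropN (i * L) x)) := by
    intro B x
    simp only [sup, blks, blk, K]
    rw [wt_add, wt_mul, Finset.prod_mul_distrib, Finset.mul_sum, Real.exp_sum]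
    ring
  have hfun : (fun x => wt A (Q * K) x * Real.exp (t *
      ∑ s ∈ Finset.range Q, ∑ i ∈ Finset.range N, agree v L (dropN (s * K + i * L) x))) =
      fun x => ∏ s ∈ Finset.range Q, sup (dropN (s * K) A) (dropN (s * K) x) := by
    ext x
    simp only [hsupeq, dropN_dropN]
    rw [wt_mul, Finset.prod_mul_distrib, Finset.mul_sum, Real.exp_sum]
  rw [hfun, wordSum_prod fun s => hsup (dropN (s * K) A), Finset.mul_sum, Real.exp_sum]
  have hfac : ∀ B i, 0 ≤ 1 + (Real.exp t - 1) * wt (dropN (i * L) B) L v := by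
    intro B i
    rw [← wordSum_tilted]
    exact Finset.sum_nonneg fun w _ => mul_nonneg (wt_nonneg _ _ _) (Real.exp_pos _).le
  refine Finset.prod_le_prod (fun s _ => ?_) fun s _ => ?_
  · rw [hsupsum]
    exact Finset.prod_nonneg fun i _ => hfac _ i
  · rw [hsupsum, Finset.mul_sum, Real.exp_sum]
    refine Finset.prod_le_prod (fun i _ => hfac _ i) fun i _ => ?_
    rw [dropN_dropN, add_comm 1]
    exact Real.add_one_le_exp _

/-- `m` is not divisible by the square of a prime below `r`. -/
def good (r m : ℕ) : Prop := ∀ p < r, p.Prime → ¬ p ^ 2 ∣ m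

/-- Indicator sequence of `good r`. -/
def beta (r : ℕ) : Omega2 := fun m => decide (good r m)

/-- A period of `beta r`. -/
def per (r : ℕ) : ℕ := r.factorial ^ 2

lemma per_pos (r : ℕ) : 0 < per r := pow_pos r.factorial_pos 2

lemma dropN_add_per (r c k : ℕ) : dropN (c + k * per r) (beta r) = dropN c (beta r) := by
  ext j
  simp only [dropN, beta, decide_eq_decide]
  refine forall₃_congr fun p hp hpp => not_congr ?_
  have h : p ^ 2 ∣ k * per r :=
    Dvd.dvd.mul_left (pow_dvd_pow_of_dvd (Nat.dvd_factorial hpp.pos hp.le) 2) k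
  rw [show c + k * per r + j = c + j + k * per r by ring, Nat.dvd_add_left h]

/-- Positions avoiding the classes `g_p` for all primes `p`. -/
def chi (g : G) : Omega2 := fun i =>
  decide (∀ p : Nat.Primes, ((i + 1 : ℕ) : ZMod ((p : ℕ) ^ 2)) ≠ g p)

/-- Positions avoiding the classes `g_p` for the primes `p < r`. -/
def chiBelow (r : ℕ) (g : G) : Omega2 := fun i =>
  decide (∀ p : Nat.Primes, (p : ℕ) < r → ((i + 1 : ℕ) : ZMod ((p : ℕ) ^ 2)) ≠ g p)

lemma exists_chiBelow_eq (r : ℕ) (g : G) :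
    ∃ c < per r, chiBelow r g = dropN c (beta r) := by
  obtain ⟨c, hc⟩ := Nat.chineseRemainderOfFinset
    (fun p : ℕ => if h : p.Prime then (1 - g ⟨p, h⟩).val else 0) (fun p => p ^ 2)
    ((Finset.range r).filter Nat.Prime)
    (fun p hp => pow_ne_zero 2 (Finset.mem_filter.1 hp).2.ne_zero)
    (fun p hp q hq hpq => Nat.Coprime.pow 2 2 ((Nat.coprime_primes
      (Finset.mem_filter.1 hp).2 (Finset.mem_filter.1 hq).2).2 hpq))
  refine ⟨c % per r, Nat.mod_lt _ (per_pos r), ?_⟩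
  have h0 : dropN (c % per r) (beta r) = dropN c (beta r) := by
    conv_rhs => rw [← Nat.mod_add_div' c (per r)]
    rw [dropN_add_per]
  rw [h0]
  ext i
  simp only [chiBelow, dropN, beta, decide_eq_decide]
  have key : ∀ p : Nat.Primes, (p : ℕ) < r →
      (((i + 1 : ℕ) : ZMod ((p : ℕ) ^ 2)) = g p ↔ (p : ℕ) ^ 2 ∣ c + i) := by
    intro p hp
    have h1 := hc p (Finset.mem_filter.2 ⟨Finset.mem_range.2 hp, p.2⟩)
    rw [dif_pos p.2, ← ZMod.natCast_eq_natCast_iff, ZMod.natCast_zmod_val] at h1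
    have h2 : ((c + i : ℕ) : ZMod ((p : ℕ) ^ 2)) = (1 - g p) + i := by
      rw [Nat.cast_add]
      exact congrArg (· + (i : ZMod ((p : ℕ) ^ 2))) h1
    rw [← ZMod.natCast_eq_zero_iff, h2, Nat.cast_add, Nat.cast_one]
    constructor
    · intro h
      rw [← h]
      ring
    · intro h
      linear_combination h
  constructor
  · intro h p hp hpp hd
    exact h ⟨p, hpp⟩ hp ((key ⟨p, hpp⟩ hp).2 hd)
  · intro h p hp he
    exact h p hp p.2 ((key p hp).1 he)

lemma SqfFlow.exists_chi {x : Omega2} (hx : x ∈ SqfFlow) :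
    ∃ g : G, ∀ i, x i = true → chi g i = true := by
  choose g hg using hx
  refine ⟨g, fun i hi => ?_⟩
  simp only [chi, decide_eq_true_eq]
  intro p hp
  simp [hg p i hp] at hi

lemma chi_le_chiBelow (r : ℕ) (g : G) (i : ℕ) (h : chi g i = true) : chiBelow r g i = true := by
  simp only [chi, chiBelow, decide_eq_true_eq] at h ⊢
  exact fun p _ => h p

lemma SqfFlow.exists_dropN_beta {x : Omega2} (hx : x ∈ SqfFlow) (r : ℕ) :
    ∃ c < per r, ∀ i, x i = true → dropN c (beta r) i = true := by
  obtain ⟨g, hg⟩ := SqfFlow.exists_chi hx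
  obtain ⟨c, hc, h⟩ := exists_chiBelow_eq r g
  exact ⟨c, hc, fun i hi => h ▸ chi_le_chiBelow r g i (hg i hi)⟩

/-- Average of `F` over the orbit of `beta r`. -/
def avg (r : ℕ) (F : Omega2 → ℝ) : ℝ :=
  (∑ j ∈ Finset.range (per r), F (dropN j (beta r))) / per r

lemma sum_range_add_of_periodic {f : ℕ → ℝ} {N : ℕ} (hf : ∀ j, f (j + N) = f j) (c : ℕ) :
    ∑ j ∈ Finset.range N, f (c + j) = ∑ j ∈ Finset.range N, f j := by
  induction c with
  | zero => simp
  | succ c ih =>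
    rw [← ih]
    have h1 := Finset.sum_range_succ (fun j => f (c + j)) N
    rw [Finset.sum_range_succ', hf] at h1
    simp only [add_zero, add_left_inj] at h1
    rw [← h1]
    exact Finset.sum_congr rfl fun j _ => by rw [add_right_comm, add_assoc]

lemma sum_dropN_beta (r : ℕ) (F : Omega2 → ℝ) (c Q : ℕ) :
    ∑ j ∈ Finset.range (Q * per r), F (dropN (c + j) (beta r)) = Q * (per r * avg r F) := by
  have hN : (per r : ℝ) ≠ 0 := by exact_mod_cast (per_pos r).ne'
  have hper : ∀ j, F (dropN (j + per r) (beta r)) = F (dropN j (beta r)) := fun j => by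
    rw [← dropN_add_per r j 1, one_mul]
  induction Q with
  | zero => simp
  | succ Q ih =>
    rw [Nat.succ_mul, Finset.sum_range_add, ih]
    have := sum_range_add_of_periodic (f := fun j => F (dropN j (beta r))) hper (c + Q * per r)
    simp only [← add_assoc, this]
    rw [avg, mul_div_cancel₀ _ hN]
    push_cast
    ring

/-- Density of the integers not divisible by the square of a prime below `r`. -/
def dens (r : ℕ) : ℝ := avg r fun A => if A 0 then 1 else 0

lemma cnt_dropN_beta (r c Q : ℕ) :
    cnt (dropN c (beta r)) (Q * per r) = Q * per r * dens r := by
  rw [dens, mul_assoc, ← sum_dropN_beta r _ c Q]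
  rfl

lemma sum_blocks_dropN_beta (r : ℕ) (F : Omega2 → ℝ) (c Q L : ℕ) :
    ∑ s ∈ Finset.range (Q * per r), ∑ i ∈ Finset.range (per r),
      F (dropN (s * (per r * L + 1) + i * L) (dropN c (beta r))) =
      per r * (Q * (per r * avg r F)) := by
  rw [Finset.sum_comm]
  have : ∀ i ∈ Finset.range (per r), ∑ s ∈ Finset.range (Q * per r),
      F (dropN (s * (per r * L + 1) + i * L) (dropN c (beta r))) = Q * (per r * avg r F) := by
    intro i _
    rw [← sum_dropN_beta r F (c + i * L) Q]
    refine Finset.sum_congr rfl fun s _ => ?_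
    rw [dropN_dropN, ← dropN_add_per r (c + i * L + s) (s * L)]
    congr 2
    ring
  rw [Finset.sum_congr rfl this]
  simp

lemma word_eq_iff {n : ℕ} {x y : Omega2} : word n x = word n y ↔ ∀ i < n, x i = y i :=
  ⟨fun h i hi => congrFun h ⟨i, hi⟩, fun h => funext fun i => h i i.2⟩

lemma partH_word_add_le {ν : Measure Omega2} [IsProbabilityMeasure ν]
    (hν : MeasurePreserving shift ν ν) (hX : ∀ᵐ x ∂ν, x ∈ SqfFlow) (v : Omega2) (L r Q : ℕ)
    (t : ℝ) :
    partH ν (word (Q * per r * (per r * L + 1))) +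
      t * (per r * (Q * (per r * ν.real (word L ⁻¹' {word L v})))) ≤
    Real.log (per r) + (Q * per r * (per r * L + 1)) * dens r * Real.log 2 +
      (Real.exp t - 1) * (per r * (Q * (per r * avg r fun A => wt A L v))) := by
  set N := per r with hN
  have hN0 : 0 < N := per_pos r
  set K := N * L + 1 with hK
  set n := Q * N * K with hn
  let S : Omega2 → ℝ := fun x => ∑ s ∈ Finset.range (Q * N), ∑ i ∈ Finset.range N,
        agree v L (dropN (s * K + i * L) x)
  have hS : LocalOn n S := by
    intro x y h
    refine Finset.sum_congr rfl fun s hs => Finset.sum_congr rfl fun i hi =>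
      localOn_agree v L _ _ fun j hj => h _ ?_
    have h1 : (s + 1) * K ≤ Q * N * K := Nat.mul_le_mul_right _ (Finset.mem_range.1 hs)
    have h2 : (i + 1) * L ≤ N * L := Nat.mul_le_mul_right _ (Finset.mem_range.1 hi)
    rw [Nat.succ_mul] at h1 h2
    omega
  let W : ℕ → Omega2 → ℝ := fun c x =>
    wt (dropN c (beta r)) n x * Real.exp (t * S x)
  have hW0 : ∀ c x, 0 ≤ W c x := fun c x => mul_nonneg (wt_nonneg _ _ _) (Real.exp_pos _).le
  let q : (Fin n → Bool) → ℝ := fun w => ∑ c ∈ Finset.range N, W c (extend0 w)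
  have hq0 : ∀ w, 0 ≤ q w := fun w => Finset.sum_nonneg fun c _ => hW0 c _
  set B := (Real.exp t - 1) * (N * (Q * (N * avg r fun A => wt A L v))) with hB
  have hqsum : ∑ w, q w ≤ N * Real.exp B := by
    simp only [q]
    rw [Finset.sum_comm]
    refine (Finset.sum_le_card_nsmul _ _ (Real.exp B) fun c _ => ?_).trans (by simp)
    refine (wordSum_tilted_blocks_le (dropN c (beta r)) v L N (Q * N) t).trans (le_of_eq ?_)
    rw [sum_blocks_dropN_beta r (fun A => wt A L v) c Q L]
  have hcnt : ∀ c, cnt (dropN c (beta r)) n = n * dens r := by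
    intro c
    rw [show n = Q * K * per r by rw [hn, hN]; ring, cnt_dropN_beta]
    push_cast
    ring
  have hlow : ∀ᵐ x ∂ν, Real.exp (-(n * dens r * Real.log 2) + t * S x) ≤ q (word n x) := by
    filter_upwards [hX] with x hx
    obtain ⟨c, hc, hfit⟩ := SqfFlow.exists_dropN_beta hx r
    refine le_trans (le_of_eq ?_)
      (Finset.single_le_sum (fun c _ => hW0 c _) (Finset.mem_range.2 hc))
    simp only [W]
    have hx' : ∀ i < n, extend0 (word n x) i = x i := fun i hi => extend0_word x hi
    rw [hS _ _ hx', localOn_wt _ n _ _ hx', wt_of_fits fun i _ => hfit i, hcnt, Real.exp_add]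
  have hpos : ∀ᵐ x ∂ν, 0 < q (word n x) := by
    filter_upwards [hlow] with x hx
    exact (Real.exp_pos _).trans_le hx
  have hG := partH_le_log_sub_integral ν (measurable_word n) hq0 hqsum
    (mul_pos (by exact_mod_cast hN0) (Real.exp_pos B)) hpos
  rw [Real.log_mul (by exact_mod_cast hN0.ne') (Real.exp_pos B).ne', Real.log_exp] at hG
  have hag : ∀ x, agree v L x = (word L ⁻¹' {word L v}).indicator (fun _ => 1) x := by
    intro x
    simp only [agree, indicator, mem_preimage, mem_singleton_iff, word_eq_iff]
  have hmeas : MeasurableSet (word L ⁻¹' {word L v}) :=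
    measurable_word L (measurableSet_singleton _)
  have hagi : Integrable (agree v L) ν := by
    rw [funext hag]
    exact (integrable_const 1).indicator hmeas
  have hdrop : ∀ k, MeasurePreserving (dropN k) ν ν := by
    intro k
    have : dropN k = shift^[k] := by
      ext x j
      rw [shift_iterate, dropN]
    rw [this]
    exact hν.iterate k
  have hagI : ∀ k, ∫ x, agree v L (dropN k x) ∂ν = ν.real (word L ⁻¹' {word L v}) := by
    intro k
    have hm := (hdrop k).map_eq
    rw [← integral_map (φ := dropN k) (f := agree v L) (hdrop k).measurable.aemeasurable
      (by rw [hm]; exact hagi.aestronglyMeasurable), hm, funext hag]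
    simp [integral_indicator_const, hmeas]
  have hagk : ∀ k, Integrable (fun x => agree v L (dropN k x)) ν := fun k =>
    (hdrop k).integrable_comp_of_integrable hagi
  have hSint : Integrable S ν :=
    integrable_finsetSum _ fun s _ => integrable_finsetSum _ fun i _ => hagk _
  have hSI : ∫ x, S x ∂ν = N * (Q * (N * ν.real (word L ⁻¹' {word L v}))) := by
    simp only [S]
    rw [integral_finsetSum _ fun s _ => integrable_finsetSum _ fun i _ => hagk _]
    simp only [integral_finsetSum _ fun i _ => hagk _, hagI]
    simp
    ring
  have hI : -(n * dens r * Real.log 2) + t * ∫ x, S x ∂ν ≤ ∫ x, Real.log (q (word n x)) ∂ν := by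
    have h1 : ∫ x, (-(n * dens r * Real.log 2) + t * S x) ∂ν ≤
        ∫ x, Real.log (q (word n x)) ∂ν := by
      refine integral_mono_ae ((integrable_const _).add (hSint.const_mul t))
        (integrable_comp_of_finite ν (measurable_word n) fun w => Real.log (q w)) ?_
      filter_upwards [hlow] with x hx
      have := Real.log_le_log (Real.exp_pos _) hx
      rwa [Real.log_exp] at this
    rwa [integral_add (integrable_const _) (hSint.const_mul t), integral_const_mul,
      integral_const, probReal_univ, one_smul] at h1
  rw [hSI] at hI
  have hncast : (n : ℝ) = Q * N * (N * L + 1) := by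
    rw [hn, hK]
    push_cast
    ring
  rw [hncast] at hI
  linarith

instance discreteMeasurableSpace_zmod (n : ℕ) : DiscreteMeasurableSpace (ZMod n) :=
  ⟨fun _ => trivial⟩

/-- Uniform measure on `ℤ/p²ℤ`. -/
def unifMod (p : Nat.Primes) : Measure (ZMod ((p : ℕ) ^ 2)) := ProbabilityTheory.uniformOn univ

instance (p : Nat.Primes) : IsProbabilityMeasure (unifMod p) :=
  ProbabilityTheory.isProbabilityMeasure_uniformOn finite_univ univ_nonempty

lemma unifMod_map_sub_one (p : Nat.Primes) : (unifMod p).map (fun a => a - 1) = unifMod p := by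
  ext s hs
  rw [Measure.map_apply (measurable_of_finite _) hs, unifMod, ProbabilityTheory.uniformOn_univ,
    ProbabilityTheory.uniformOn_univ]
  congr 1
  have h : (fun a : ZMod ((p : ℕ) ^ 2) => a - 1) ⁻¹' s = (fun a => a + 1) '' s := by
    ext a
    constructor
    · exact fun h => ⟨a - 1, h, by ring⟩
    · rintro ⟨b, hb, rfl⟩
      simpa using hb
  rw [h, Measure.count_injective_image (add_left_injective 1)]

/-- Haar probability measure on `G`. -/
def haarG : Measure G := Measure.infinitePi unifMod

instance : IsProbabilityMeasure haarG := by unfold haarG; infer_instance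

lemma measurePreserving_T1 : MeasurePreserving T1 haarG haarG := by
  refine ⟨measurable_pi_iff.2 fun p => (measurable_of_finite fun a : ZMod ((p : ℕ) ^ 2) => a - 1).comp
    (measurable_pi_apply p), ?_⟩
  have := Measure.infinitePi_map_pi unifMod (f := fun p (a : ZMod ((p : ℕ) ^ 2)) => a - 1)
    fun p => measurable_of_finite _
  simp only [unifMod_map_sub_one] at this
  exact this

/-- The fair coin. -/
def coin : Measure Bool := ProbabilityTheory.uniformOn univ

instance : IsProbabilityMeasure coin :=
  ProbabilityTheory.isProbabilityMeasure_uniformOn finite_univ univ_nonempty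

/-- Bernoulli measure. -/
def bern : Measure Omega2 := Measure.infinitePi fun _ => coin

instance : IsProbabilityMeasure bern := by unfold bern; infer_instance

lemma measurePreserving_shift_bern : MeasurePreserving shift bern bern := by
  refine ⟨measurable_shift, Measure.eq_infinitePi _ fun s t ht => ?_⟩
  have h : shift ⁻¹' Set.pi (s : Set ℕ) t =
      Set.pi ((s.image (· + 1) : Finset ℕ) : Set ℕ) fun i => t (i - 1) := by
    ext x
    simp [shift, Set.mem_pi]
  rw [Measure.map_apply measurable_shift (.pi s.countable_toSet fun i _ => ht i), h, bern,
    Measure.infinitePi_pi _ fun i _ => ht _, Finset.prod_image fun a _ b _ h => by simpa using h]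
  simp

lemma measurable_chi : Measurable chi := by
  refine measurable_pi_iff.2 fun i => measurable_to_bool ?_
  have : (fun g => chi g i) ⁻¹' {true} =
      ⋂ p : Nat.Primes, (fun g : G => g p) ⁻¹' {((i + 1 : ℕ) : ZMod ((p : ℕ) ^ 2))}ᶜ := by
    ext g
    simp [chi, eq_comm]
  rw [this]
  exact .iInter fun p => measurable_pi_apply p (MeasurableSet.singleton _).compl

lemma measurable_chiBelow (r : ℕ) : Measurable (chiBelow r) := by
  refine measurable_pi_iff.2 fun i => measurable_to_bool ?_
  have : (fun g => chiBelow r g i) ⁻¹' {true} =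
      ⋂ p : Nat.Primes, ⋂ _ : (p : ℕ) < r,
        (fun g : G => g p) ⁻¹' {((i + 1 : ℕ) : ZMod ((p : ℕ) ^ 2))}ᶜ := by
    ext g
    simp [chiBelow, eq_comm]
  rw [this]
  exact .iInter fun p => .iInter fun _ => measurable_pi_apply p (MeasurableSet.singleton _).compl

lemma chi_T1 (g : G) : chi (T1 g) = shift (chi g) := by
  ext i
  refine decide_eq_decide.2 (forall_congr' fun p => not_congr ?_)
  simp only [T1]
  push_cast
  exact eq_sub_iff_add_eq

lemma chiBelow_T1 (r : ℕ) (g : G) : chiBelow r (T1 g) = shift (chiBelow r g) := by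
  ext i
  refine decide_eq_decide.2 (forall₂_congr fun p _ => not_congr ?_)
  simp only [T1]
  push_cast
  exact eq_sub_iff_add_eq

/-- Pointwise product of 0-1 sequences, with the first factor an omitting sequence. -/
def mask (z : G × Omega2) : Omega2 := fun i => chi z.1 i && z.2 i

lemma measurable_mask : Measurable mask := by
  refine measurable_pi_iff.2 fun i => ?_
  have h1 : Measurable fun z : G × Omega2 => chi z.1 i :=
    (measurable_pi_apply i).comp (measurable_chi.comp measurable_fst)
  have h2 : Measurable fun z : G × Omega2 => z.2 i := (measurable_pi_apply i).comp measurable_snd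
  exact (measurable_of_finite fun b : Bool × Bool => b.1 && b.2).comp (h1.prodMk h2)

lemma mask_mem (z : G × Omega2) : mask z ∈ SqfFlow := by
  intro p
  refine ⟨z.1 p, fun n hn => ?_⟩
  have : chi z.1 n = false := by
    simp only [chi, decide_eq_false_iff_not]
    exact fun h => h p hn
  simp [mask, this]

/-- The measure of maximal entropy. -/
def mme : Measure Omega2 := (haarG.prod bern).map mask

instance : IsProbabilityMeasure mme :=
  Measure.isProbabilityMeasure_map measurable_mask.aemeasurable

lemma measurePreserving_shift_mme : MeasurePreserving shift mme mme := by
  refine ⟨measurable_shift, ?_⟩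
  have h : shift ∘ mask = mask ∘ Prod.map T1 shift := by
    ext z i
    simp [mask, chi_T1, shift]
  have h2 := (measurePreserving_T1.prod measurePreserving_shift_bern)
  rw [mme, Measure.map_map measurable_shift measurable_mask, h,
    ← Measure.map_map measurable_mask h2.measurable, h2.map_eq]

lemma mme_SqfFlow : mme SqfFlow = 1 := by
  refine le_antisymm prob_le_one ?_
  calc (1 : ℝ≥0∞) = (haarG.prod bern) (mask ⁻¹' SqfFlow) := by
        rw [eq_univ_of_forall (s := mask ⁻¹' SqfFlow) mask_mem, measure_univ]
    _ ≤ mme SqfFlow := Measure.le_map_apply measurable_mask.aemeasurable _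

lemma bern_mask (A v : Omega2) (L : ℕ) :
    bern {y | ∀ i < L, (A i && y i) = v i} = ENNReal.ofReal (wt A L v) := by
  have h : {y : Omega2 | ∀ i < L, (A i && y i) = v i} =
      Set.pi ((Finset.range L : Finset ℕ) : Set ℕ) fun i => {b | (A i && b) = v i} := by
    ext y
    simp [Set.mem_pi]
  rw [h, bern, Measure.infinitePi_pi _ fun i _ => MeasurableSet.of_discrete, wt,
    ENNReal.ofReal_prod_of_nonneg fun i _ => by split_ifs <;> norm_num]
  have key : Measure.count ({false, true} : Set Bool) = 2 := by
    rw [← Finset.coe_pair, Measure.count_apply_finset]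
    rfl
  refine Finset.prod_congr rfl fun i _ => ?_
  rw [coin, ProbabilityTheory.uniformOn_univ]
  cases hA : A i
  · cases hv : v i <;> simp [ENNReal.div_self, key]
  · simp

lemma measurable_wt (L : ℕ) (v : Omega2) : Measurable fun A => wt A L v :=
  Finset.measurable_prod _ fun i _ =>
    (measurable_of_finite fun b : Bool => (if b then 1 / 2 else if v i then 0 else 1 : ℝ)).comp
      (measurable_pi_apply i)

lemma mme_cylinder (v : Omega2) (L : ℕ) :
    mme.real (word L ⁻¹' {word L v}) = ∫ g, wt (chi g) L v ∂haarG := by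
  rw [integral_eq_lintegral_of_nonneg_ae (ae_of_all _ fun g => wt_nonneg _ _ _)
    ((measurable_wt L v).comp measurable_chi).aestronglyMeasurable, measureReal_def]
  congr 1
  have hC : MeasurableSet (word L ⁻¹' {word L v}) := measurable_word L (MeasurableSet.singleton _)
  rw [mme, Measure.map_apply measurable_mask hC, Measure.prod_apply (measurable_mask hC)]
  refine lintegral_congr fun g => ?_
  rw [← bern_mask]
  congr 1
  ext y
  simp [word_eq_iff, mask]

lemma LocalOn.eq_extend0 {L : ℕ} {F : Omega2 → ℝ} (hF : LocalOn L F) (x : Omega2) :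
    F x = F (extend0 (word L x)) :=
  hF _ _ fun _ hi => (extend0_word x hi).symm

lemma LocalOn.measurable {L : ℕ} {F : Omega2 → ℝ} (hF : LocalOn L F) : Measurable F := by
  rw [funext hF.eq_extend0]
  exact (measurable_of_finite fun w : Fin L → Bool => F (extend0 w)).comp (measurable_word L)

lemma LocalOn.exists_bound {L : ℕ} {F : Omega2 → ℝ} (hF : LocalOn L F) : ∃ C, ∀ x, ‖F x‖ ≤ C :=
  ⟨∑ w : Fin L → Bool, ‖F (extend0 w)‖, fun x => by
    rw [hF.eq_extend0]
    exact Finset.single_le_sum (f := fun w : Fin L → Bool => ‖F (extend0 w)‖)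
      (fun _ _ => norm_nonneg _) (Finset.mem_univ (word L x))⟩

lemma LocalOn.integrable_comp {L : ℕ} {F : Omega2 → ℝ} (hF : LocalOn L F) {f : G → Omega2}
    (hf : Measurable f) : Integrable (fun g => F (f g)) haarG := by
  obtain ⟨C, hC⟩ := hF.exists_bound
  exact Integrable.of_bound (hF.measurable.comp hf).aestronglyMeasurable C
    (ae_of_all _ fun g => hC _)

lemma dropN_succ_eq (j : ℕ) (x : Omega2) : dropN (j + 1) x = dropN j (shift x) := by
  ext i
  simp only [dropN, shift]
  congr 1
  ring

lemma measurable_dropN (j : ℕ) : Measurable (dropN j) :=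
  measurable_pi_iff.2 fun _ => measurable_pi_apply _

lemma integral_dropN_of_equivariant {L : ℕ} {F : Omega2 → ℝ} (hF : LocalOn L F) {f : G → Omega2}
    (hf : Measurable f) (hfT : ∀ g, f (T1 g) = shift (f g)) (j : ℕ) :
    ∫ g, F (dropN j (f g)) ∂haarG = ∫ g, F (f g) ∂haarG := by
  induction j with
  | zero =>
    refine integral_congr_ae (ae_of_all _ fun g => congrArg F ?_)
    ext i
    simp [dropN]
  | succ j ih =>
    rw [← ih]
    simp only [dropN_succ_eq, ← hfT]
    have hm : Measurable fun g => F (dropN j (f g)) :=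
      hF.measurable.comp ((measurable_dropN j).comp hf)
    conv_rhs => rw [← measurePreserving_T1.map_eq]
    exact (integral_map measurePreserving_T1.measurable.aemeasurable hm.aestronglyMeasurable).symm

lemma integral_chiBelow {L : ℕ} {F : Omega2 → ℝ} (hF : LocalOn L F) (r : ℕ) :
    ∫ g, F (chiBelow r g) ∂haarG = avg r F := by
  have hN : (per r : ℝ) ≠ 0 := by exact_mod_cast (per_pos r).ne'
  have h1 : ∑ j ∈ Finset.range (per r), ∫ g, F (dropN j (chiBelow r g)) ∂haarG =
      per r * ∫ g, F (chiBelow r g) ∂haarG := by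
    simp [integral_dropN_of_equivariant hF (measurable_chiBelow r) (chiBelow_T1 r)]
  have h0 := integral_finsetSum (μ := haarG) (f := fun j g => F (dropN j (chiBelow r g)))
    (Finset.range (per r)) fun j _ =>
      hF.integrable_comp ((measurable_dropN j).comp (measurable_chiBelow r))
  rw [← h0] at h1
  have h2 : ∀ g, ∑ j ∈ Finset.range (per r), F (dropN j (chiBelow r g)) = per r * avg r F := by
    intro g
    obtain ⟨c, -, hc⟩ := exists_chiBelow_eq r g
    have := sum_dropN_beta r F c 1
    simp only [one_mul, Nat.cast_one] at this
    rw [hc, ← this]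
    simp only [dropN_dropN]
  simp only [h2] at h1
  simp at h1
  rcases h1 with h1 | h1
  · exact h1.symm
  · exact absurd (by exact_mod_cast h1) hN

lemma eventually_chiBelow_eq (g : G) (i : ℕ) : ∀ᶠ r in atTop, chiBelow r g i = chi g i := by
  by_cases h : chi g i = true
  · exact Eventually.of_forall fun r => by rw [h, chi_le_chiBelow r g i h]
  · have h' := h
    simp only [chi, decide_eq_true_eq] at h'
    push Not at h'
    obtain ⟨p, hp⟩ := h'
    filter_upwards [eventually_gt_atTop (p : ℕ)] with r hr
    rw [Bool.not_eq_true] at h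
    rw [h]
    simp only [chiBelow, decide_eq_false_iff_not]
    exact fun h2 => h2 p hr hp

lemma tendsto_avg {L : ℕ} {F : Omega2 → ℝ} (hF : LocalOn L F) :
    Tendsto (fun r => avg r F) atTop (nhds (∫ g, F (chi g) ∂haarG)) := by
  simp only [← integral_chiBelow hF]
  obtain ⟨C, hC⟩ := hF.exists_bound
  refine tendsto_integral_of_dominated_convergence (fun _ => C)
    (fun r => (hF.measurable.comp (measurable_chiBelow r)).aestronglyMeasurable)
    (integrable_const C) (fun r => ae_of_all _ fun g => hC _) (ae_of_all _ fun g => ?_)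
  refine tendsto_const_nhds.congr' ?_
  have : ∀ᶠ r in atTop, ∀ i ∈ Finset.range L, chiBelow r g i = chi g i :=
    (Finset.eventually_all _).2 fun i _ => eventually_chiBelow_eq g i
  filter_upwards [this] with r hr
  exact hF _ _ fun i hi => (hr i (Finset.mem_range.2 hi)).symm

lemma localOn_head : LocalOn 1 fun A => if A 0 then (1 : ℝ) else 0 := fun x y h => by
  simp [h 0 one_pos]

/-- Probability that `0` is an admitted position. -/
def densLim : ℝ := ∫ g, (if chi g 0 then (1 : ℝ) else 0) ∂haarG

lemma tendsto_dens : Tendsto dens atTop (nhds densLim) := tendsto_avg localOn_head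

lemma tendsto_avg_wt (v : Omega2) (L : ℕ) :
    Tendsto (fun r => avg r fun A => wt A L v) atTop
      (nhds (mme.real (word L ⁻¹' {word L v}))) := by
  rw [mme_cylinder]
  exact tendsto_avg (localOn_wt_left L v)

lemma sum_negMulLog_wt (A : Omega2) (n : ℕ) :
    ∑ w : Fin n → Bool, Real.negMulLog (wt A n (extend0 w)) = cnt A n * Real.log 2 := by
  have h : ∀ w : Fin n → Bool, Real.negMulLog (wt A n (extend0 w)) =
      wt A n (extend0 w) * (cnt A n * Real.log 2) := by
    intro w
    by_cases hw : ∀ i < n, extend0 w i = true → A i = true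
    · rw [Real.negMulLog, wt_of_fits hw, Real.log_exp]
      ring
    · simp [wt_eq_zero hw]
  rw [Finset.sum_congr rfl fun w _ => h w, ← Finset.sum_mul]
  have := wordSum_wt A n
  unfold wordSum at this
  rw [this, one_mul]

lemma integral_cnt_chi (n : ℕ) : ∫ g, cnt (chi g) n ∂haarG = n * densLim := by
  unfold cnt
  have h : ∀ i, (fun g => if chi g i then (1 : ℝ) else 0) =
      fun g => (fun A : Omega2 => if A 0 then (1 : ℝ) else 0) (dropN i (chi g)) := fun i => by
    simp [dropN]
  rw [integral_finsetSum _ fun i _ => by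
    rw [h]; exact localOn_head.integrable_comp ((measurable_dropN i).comp measurable_chi)]
  simp only [h, integral_dropN_of_equivariant localOn_head measurable_chi chi_T1]
  simp [densLim]

lemma le_partH_mme (n : ℕ) : n * (densLim * Real.log 2) ≤ partH mme (word n) := by
  have h_int : ∀ w : Fin n → Bool,
      Integrable (fun g => Real.negMulLog (wt (chi g) n (extend0 w))) haarG := fun w => by
    refine LocalOn.integrable_comp (L := n)
      (F := fun A => Real.negMulLog (wt A n (extend0 w))) ?_ measurable_chi
    intro x y h
    exact congrArg Real.negMulLog (localOn_wt_left n _ x y h)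
  calc n * (densLim * Real.log 2) = ∫ g, cnt (chi g) n * Real.log 2 ∂haarG := by
        rw [integral_mul_const, integral_cnt_chi, mul_assoc]
    _ = ∑ w : Fin n → Bool, ∫ g, Real.negMulLog (wt (chi g) n (extend0 w)) ∂haarG := by
        rw [← integral_finsetSum _ fun w _ => h_int w]
        simp only [sum_negMulLog_wt]
    _ ≤ partH mme (word n) := by
        refine Finset.sum_le_sum fun w _ => ?_
        have hw : w = word n (extend0 w) := funext fun i => (extend0_apply w i).symm
        have := mme_cylinder (extend0 w) n
        rw [← hw, measureReal_def] at this
        rw [this]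
        exact Real.concaveOn_negMulLog.le_map_integral Real.continuous_negMulLog.continuousOn
          isClosed_Ici (ae_of_all _ fun g => wt_nonneg _ _ _)
          ((localOn_wt_left n _).integrable_comp measurable_chi) (h_int w)

/-- Initial words of length `n` of elements of the squarefree flow. -/
def sqfWords (n : ℕ) : Finset (Fin n → Bool) :=
  Finset.univ.filter fun w => ∃ x ∈ SqfFlow, word n x = w

lemma word_mem_sqfWords {x : Omega2} (hx : x ∈ SqfFlow) (n : ℕ) : word n x ∈ sqfWords n :=
  Finset.mem_filter.2 ⟨Finset.mem_univ _, x, hx, rfl⟩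

lemma cnt_mono (A : Omega2) {m n : ℕ} (h : m ≤ n) : cnt A m ≤ cnt A n :=
  Finset.sum_le_sum_of_subset_of_nonneg (Finset.range_subset_range.2 h)
    fun i _ _ => by split_ifs <;> norm_num

lemma dens_nonneg (r : ℕ) : 0 ≤ dens r :=
  div_nonneg (Finset.sum_nonneg fun j _ => by
    beta_reduce
    split_ifs <;> norm_num) (Nat.cast_nonneg _)

lemma cnt_dropN_beta_le (r c m : ℕ) : cnt (dropN c (beta r)) m ≤ (m + per r) * dens r := by
  have h1 : m ≤ (m / per r + 1) * per r := by
    have := Nat.lt_div_mul_add (a := m) (per_pos r)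
    rw [add_mul]
    omega
  refine (cnt_mono _ h1).trans ?_
  rw [cnt_dropN_beta]
  refine mul_le_mul_of_nonneg_right ?_ (dens_nonneg r)
  have : ((m / per r * per r : ℕ) : ℝ) ≤ m := by exact_mod_cast Nat.div_mul_le_self m (per r)
  push_cast at this ⊢
  linarith

lemma card_fitting_le (A : Omega2) (n : ℕ) :
    ((Finset.univ.filter fun w : Fin n → Bool => ∀ i < n, extend0 w i = true → A i = true).card : ℝ)
      ≤ Real.exp (cnt A n * Real.log 2) := by
  set S := Finset.univ.filter fun w : Fin n → Bool => ∀ i < n, extend0 w i = true → A i = true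
    with hS
  have h1 : ∑ w ∈ S, wt A n (extend0 w) ≤ 1 := by
    rw [← wordSum_wt A n]
    exact Finset.sum_le_sum_of_subset_of_nonneg (Finset.subset_univ _)
      fun w _ _ => wt_nonneg _ _ _
  rw [Finset.sum_congr rfl fun w hw => wt_of_fits (Finset.mem_filter.1 hw).2, Finset.sum_const,
    nsmul_eq_mul, Real.exp_neg, ← div_eq_mul_inv, div_le_one (Real.exp_pos _)] at h1
  exact h1

lemma card_sqfWords_le (r n : ℕ) :
    ((sqfWords n).card : ℝ) ≤ per r * Real.exp ((n + per r) * dens r * Real.log 2) := by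
  have hsub : sqfWords n ⊆ (Finset.range (per r)).biUnion fun c =>
      Finset.univ.filter fun w : Fin n → Bool =>
        ∀ i < n, extend0 w i = true → dropN c (beta r) i = true := by
    intro w hw
    obtain ⟨x, hx, rfl⟩ := (Finset.mem_filter.1 hw).2
    obtain ⟨c, hc, h⟩ := SqfFlow.exists_dropN_beta hx r
    refine Finset.mem_biUnion.2 ⟨c, Finset.mem_range.2 hc, Finset.mem_filter.2
      ⟨Finset.mem_univ _, fun i hi hxi => h i ?_⟩⟩
    rwa [extend0_word x hi] at hxi
  have h1 : ((sqfWords n).card : ℝ) ≤ ∑ c ∈ Finset.range (per r),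
      ((Finset.univ.filter fun w : Fin n → Bool =>
        ∀ i < n, extend0 w i = true → dropN c (beta r) i = true).card : ℝ) := by
    exact_mod_cast (Finset.card_le_card hsub).trans Finset.card_biUnion_le
  refine h1.trans ((Finset.sum_le_card_nsmul _ _ (Real.exp ((n + per r) * dens r * Real.log 2))
    fun c _ => (card_fitting_le _ n).trans ?_).trans ?_)
  · exact Real.exp_le_exp.2
      (mul_le_mul_of_nonneg_right (cnt_dropN_beta_le r c n) (Real.log_nonneg one_le_two))
  · simp

lemma zero_mem_SqfFlow : (fun _ => false : Omega2) ∈ SqfFlow := fun _ => ⟨0, fun _ _ => rfl⟩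

lemma card_sqfWords_pos (n : ℕ) : 0 < (sqfWords n).card :=
  Finset.card_pos.2 ⟨_, word_mem_sqfWords zero_mem_SqfFlow n⟩

lemma partH_word_le_log_card {ν : Measure Omega2} [IsProbabilityMeasure ν]
    (hX : ∀ᵐ x ∂ν, x ∈ SqfFlow) (n : ℕ) : partH ν (word n) ≤ Real.log (sqfWords n).card :=
  partH_le_log_card ν (measurable_word n) (hX.mono fun _ hx => word_mem_sqfWords hx n)

lemma partH_word_le {ν : Measure Omega2} [IsProbabilityMeasure ν]
    (hX : ∀ᵐ x ∂ν, x ∈ SqfFlow) (r n : ℕ) :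
    partH ν (word n) ≤ Real.log (per r) + (n + per r) * dens r * Real.log 2 := by
  have hN : (0 : ℝ) < per r := by exact_mod_cast per_pos r
  refine (partH_word_le_log_card hX n).trans ?_
  have := Real.log_le_log (by exact_mod_cast card_sqfWords_pos n) (card_sqfWords_le r n)
  rwa [Real.log_mul hN.ne' (Real.exp_ne_zero _), Real.log_exp] at this

lemma measurableSet_SqfFlow : MeasurableSet SqfFlow := by
  have h : SqfFlow = ⋂ p : Nat.Primes, ⋃ a : ZMod ((p : ℕ) ^ 2), ⋂ n : ℕ,
      ⋂ _ : ((n + 1 : ℕ) : ZMod ((p : ℕ) ^ 2)) = a, (fun x : Omega2 => x n) ⁻¹' {false} := by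
    ext x
    simp only [SqfFlow, OmitsMod, mem_ofPred_eq, mem_iInter, mem_iUnion, mem_preimage,
      mem_singleton_iff]
  rw [h]
  exact .iInter fun p => .iUnion fun a => .iInter fun n => .iInter fun _ =>
    measurable_pi_apply n (MeasurableSet.singleton _)

lemma ae_mem_SqfFlow {ν : Measure Omega2} [IsProbabilityMeasure ν] (h : ν SqfFlow = 1) :
    ∀ᵐ x ∂ν, x ∈ SqfFlow :=
  (mem_ae_iff_prob_eq_one measurableSet_SqfFlow).2 h

open scoped Uniformity

lemma agree_mem_uniformity_iff {U : Set (Omega2 × Omega2)} (hU : U ∈ 𝓤 Omega2) :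
    ∃ L, ∀ x y : Omega2, (∀ i < L, x i = y i) → (x, y) ∈ U := by
  rw [Pi.uniformity, mem_iInf_finite] at hU
  obtain ⟨t, ht⟩ := hU
  refine ⟨t.sup id + 1, fun x y h => ?_⟩
  have : 𝓟 {(x, y)} ≤ ⨅ i ∈ t, Filter.comap (fun a : Omega2 × Omega2 => (a.1 i, a.2 i)) (𝓤 Bool) := by
    refine le_iInf₂ fun i hi => ?_
    rw [← map_le_iff_le_comap, map_principal, image_singleton]
    simp only
    rw [h i (Nat.lt_succ_of_le (Finset.le_sup (f := id) hi))]
    exact le_trans (principal_mono.2 (singleton_subset_iff.2 (rfl : (y i, y i) ∈ SetRel.id)))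
      refl_le_uniformity
  exact this ht rfl

lemma head_mem_uniformity : {z : Omega2 × Omega2 | z.1 0 = z.2 0} ∈ 𝓤 Omega2 := by
  have h : {z : Bool × Bool | z.1 = z.2} ∈ 𝓤 Bool := by
    rw [DiscreteUniformity.eq_principal_setRelId]
    exact fun _ => id
  rw [Pi.uniformity]
  exact mem_iInf_of_mem 0 ⟨_, h, Subset.rfl⟩

lemma coverMincard_le_card_sqfWords {U : Set (Omega2 × Omega2)} {L : ℕ}
    (hL : ∀ x y : Omega2, (∀ i < L, x i = y i) → (x, y) ∈ U) (n : ℕ) :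
    Dynamics.coverMincard shift SqfFlow U n ≤ (sqfWords (n + L)).card := by
  have h : Dynamics.IsDynCoverOf shift SqfFlow U n
      ((sqfWords (n + L)).image extend0 : Finset Omega2) := by
    intro x hx
    refine ⟨extend0 (word (n + L) x),
      Finset.mem_coe.2 (Finset.mem_image_of_mem _ (word_mem_sqfWords hx _)), ?_⟩
    refine Dynamics.mem_dynEntourage.2 fun k hk => hL _ _ fun i hi => ?_
    rw [shift_iterate, shift_iterate, extend0_word x (by omega)]
  exact h.coverMincard_le_card.trans (by exact_mod_cast Finset.card_image_le)

lemma card_sqfWords_le_coverMincard (n : ℕ) :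
    ((sqfWords n).card : ℕ∞) ≤
      Dynamics.coverMincard shift SqfFlow {z : Omega2 × Omega2 | z.1 0 = z.2 0} n := by
  refine le_iInf₂ fun s hs => ?_
  have h : sqfWords n ⊆ s.image (word n) := by
    intro w hw
    obtain ⟨x, hx, rfl⟩ := (Finset.mem_filter.1 hw).2
    obtain ⟨y, hy, hxy⟩ := hs hx
    refine Finset.mem_image.2 ⟨y, hy, word_eq_iff.2 fun i hi => ?_⟩
    have := Dynamics.mem_dynEntourage.1 hxy i hi
    simpa [shift_iterate] using this.symm
  exact_mod_cast (Finset.card_le_card h).trans Finset.card_image_le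

lemma coverEntropy_le_dens (r : ℕ) :
    Dynamics.coverEntropy shift SqfFlow ≤ ((dens r * Real.log 2 : ℝ) : EReal) := by
  refine iSup₂_le fun U hU => ?_
  obtain ⟨L, hL⟩ := agree_mem_uniformity_iff hU
  have h : ∀ n : ℕ, ((Dynamics.coverMincard shift SqfFlow U n : ℕ∞) : ℝ≥0∞) ≤
      ENNReal.ofReal (per r * Real.exp ((L + per r) * dens r * Real.log 2)) *
        EReal.exp (((dens r * Real.log 2 : ℝ) : EReal) * n) := by
    intro n
    have h1 : (((dens r * Real.log 2 : ℝ) : EReal) * n) = ((dens r * Real.log 2 * n : ℝ) : EReal) := by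
      push_cast
      rfl
    rw [h1, EReal.exp_coe, ← ENNReal.ofReal_mul (by positivity), mul_assoc, ← Real.exp_add]
    calc ((Dynamics.coverMincard shift SqfFlow U n : ℕ∞) : ℝ≥0∞)
        ≤ (((sqfWords (n + L)).card : ℕ∞) : ℝ≥0∞) :=
          ENat.toENNReal_le.2 (coverMincard_le_card_sqfWords hL n)
      _ = ENNReal.ofReal (sqfWords (n + L)).card := by simp
      _ ≤ _ := by
        refine ENNReal.ofReal_le_ofReal ((card_sqfWords_le r (n + L)).trans (le_of_eq ?_))
        congr 2
        push_cast
        ring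
  exact (ExpGrowth.expGrowthSup_le_of_eventually_le ENNReal.ofReal_ne_top (Eventually.of_forall h)).trans
    ExpGrowth.expGrowthSup_exp.le

lemma coverEntropy_SqfFlow :
    Dynamics.coverEntropy shift SqfFlow = ((densLim * Real.log 2 : ℝ) : EReal) := by
  apply le_antisymm
  · have h : Tendsto (fun r => ((dens r * Real.log 2 : ℝ) : EReal)) atTop
        (nhds ((densLim * Real.log 2 : ℝ) : EReal)) :=
      (continuous_coe_real_ereal.tendsto _).comp (tendsto_dens.mul_const _)
    exact ge_of_tendsto' h coverEntropy_le_dens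
  · refine le_trans ?_ (Dynamics.coverEntropyEntourage_le_coverEntropy shift SqfFlow
      head_mem_uniformity)
    refine Eventually.le_expGrowthInf (Eventually.of_forall fun n => ?_) |>.trans
      ExpGrowth.expGrowthInf_le_expGrowthSup
    have h1 : (((densLim * Real.log 2 : ℝ) : EReal) * n) =
        ((n * (densLim * Real.log 2) : ℝ) : EReal) := by
      push_cast
      exact mul_comm _ _
    rw [h1, EReal.exp_coe]
    calc ENNReal.ofReal (Real.exp (n * (densLim * Real.log 2)))
        ≤ ENNReal.ofReal (sqfWords n).card := by
          refine ENNReal.ofReal_le_ofReal ?_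
          rw [← Real.le_log_iff_exp_le (by exact_mod_cast card_sqfWords_pos n)]
          exact (le_partH_mme n).trans (partH_word_le_log_card (ae_mem_SqfFlow mme_SqfFlow) n)
      _ = (((sqfWords n).card : ℕ∞) : ℝ≥0∞) := by simp
      _ ≤ _ := ENat.toENNReal_le.2 (card_sqfWords_le_coverMincard n)

lemma procH_le {α : Type*} [MeasurableSpace α] (μ : Measure α) [IsProbabilityMeasure μ]
    (T : α → α) {k : ℕ} (f : α → Fin k) (n : ℕ) :
    procH μ T f ≤ partH μ (fun x (i : Fin (n + 1)) => f (T^[(i : ℕ)] x)) / (n + 1) :=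
  ciInf_le ⟨0, by
    rintro _ ⟨m, rfl⟩
    exact div_nonneg (partH_nonneg _ _) (by positivity)⟩ n

lemma procH_le_densLim {ν : Measure Omega2} [IsProbabilityMeasure ν]
    (hν : MeasurePreserving shift ν ν) (hX : ∀ᵐ x ∂ν, x ∈ SqfFlow) {k : ℕ} {f : Omega2 → Fin k}
    (hf : Measurable f) : procH ν shift f ≤ densLim * Real.log 2 := by
  refine le_of_forall_pos_le_add fun δ hδ => ?_
  obtain ⟨L, hL⟩ := partH_itinerary_le ν hν hf hδ
  have h1 : ∀ r, procH ν shift f ≤ dens r * Real.log 2 + δ := by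
    intro r
    have h2 : ∀ n : ℕ, procH ν shift f ≤
        (Real.log (per r) + (L + per r) * dens r * Real.log 2) * (1 / ((n : ℝ) + 1)) +
          (dens r * Real.log 2 + δ) := by
      intro n
      refine (procH_le ν shift f n).trans ?_
      have hn : (0 : ℝ) < n + 1 := by positivity
      have h3 := hL (n + 1)
      have h4 := partH_word_le hX r (n + 1 + L)
      push_cast at h3 h4
      rw [div_le_iff₀ hn, add_mul, mul_assoc, one_div, inv_mul_cancel₀ hn.ne']
      linarith
    have h5 := (tendsto_one_div_add_atTop_nhds_zero_nat (𝕜 := ℝ)).const_mul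
      (Real.log (per r) + (L + per r) * dens r * Real.log 2) |>.add_const (dens r * Real.log 2 + δ)
    rw [mul_zero, zero_add] at h5
    exact ge_of_tendsto' h5 h2
  exact ge_of_tendsto' ((tendsto_dens.mul_const _).add_const δ) h1

lemma ksEntropy_le {ν : Measure Omega2} [IsProbabilityMeasure ν]
    (hν : MeasurePreserving shift ν ν) (hX : ∀ᵐ x ∂ν, x ∈ SqfFlow) :
    ksEntropy ν shift ≤ ((densLim * Real.log 2 : ℝ) : EReal) :=
  iSup_le fun _ => iSup₂_le fun _ hf => EReal.coe_le_coe_iff.2 (procH_le_densLim hν hX hf)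

lemma ksEntropy_mme : ksEntropy mme shift = ((densLim * Real.log 2 : ℝ) : EReal) := by
  refine le_antisymm (ksEntropy_le measurePreserving_shift_mme (ae_mem_SqfFlow mme_SqfFlow)) ?_
  have hf : Measurable fun x : Omega2 => finTwoEquiv.symm (x 0) :=
    (measurable_of_finite finTwoEquiv.symm).comp (measurable_pi_apply 0)
  refine le_iSup_of_le 2 (le_iSup₂_of_le _ hf (EReal.coe_le_coe_iff.2 (le_ciInf fun n => ?_)))
  have h : (fun (x : Omega2) (i : Fin (n + 1)) => finTwoEquiv.symm (shift^[(i : ℕ)] x 0)) =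
      fun x => (Equiv.refl (Fin (n + 1))).arrowCongr finTwoEquiv.symm (word (n + 1) x) := by
    ext x i
    simp [shift_iterate, word]
  rw [h, partH_comp_equiv, le_div_iff₀ (by positivity), mul_comm]
  exact_mod_cast le_partH_mme (n + 1)

lemma exists_le_partH_word {ν : Measure Omega2} [IsProbabilityMeasure ν]
    (hν : MeasurePreserving shift ν ν)
    {h : ℝ} (hh : ksEntropy ν shift = (h : EReal)) {ε : ℝ} (hε : 0 < ε) :
    ∃ K : ℝ, ∀ N : ℕ, N * (h - ε) - K ≤ partH ν (word N) := by
  have hlt : ((h - ε / 2 : ℝ) : EReal) < ksEntropy ν shift := by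
    rw [hh]
    exact_mod_cast (by linarith : h - ε / 2 < h)
  simp only [ksEntropy, lt_iSup_iff, EReal.coe_lt_coe_iff] at hlt
  obtain ⟨k, f, hf, hlt⟩ := hlt
  obtain ⟨L, hL⟩ := partH_itinerary_le ν hν hf (half_pos hε)
  refine ⟨L * |h - ε|, fun N => ?_⟩
  rcases le_or_gt N L with hN | hN
  · have h1 : (N : ℝ) * (h - ε) ≤ L * |h - ε| :=
      (mul_le_mul_of_nonneg_left (le_abs_self _) (Nat.cast_nonneg _)).trans
        (mul_le_mul_of_nonneg_right (by exact_mod_cast hN) (abs_nonneg _))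
    linarith [partH_nonneg ν (word N)]
  · obtain ⟨n, rfl⟩ : ∃ n, N = n + 1 + L := ⟨N - L - 1, by omega⟩
    have hn : (0 : ℝ) < n + 1 := by positivity
    have h1 := hL (n + 1)
    have h2 := (hlt.trans_le (procH_le ν shift f n)).le
    rw [le_div_iff₀ hn] at h2
    have h3 : (L : ℝ) * (h - ε) ≤ L * |h - ε| :=
      mul_le_mul_of_nonneg_left (le_abs_self _) (Nat.cast_nonneg _)
    push_cast at h1 ⊢
    linarith

lemma mul_cylinder_le {ν : Measure Omega2} [IsProbabilityMeasure ν]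
    (hν : MeasurePreserving shift ν ν) (hX : ∀ᵐ x ∂ν, x ∈ SqfFlow)
    (hh : ksEntropy ν shift = ((densLim * Real.log 2 : ℝ) : EReal)) (v : Omega2) (L : ℕ) (t : ℝ) :
    t * ν.real (word L ⁻¹' {word L v}) ≤
      (Real.exp t - 1) * mme.real (word L ⁻¹' {word L v}) := by
  set a := ν.real (word L ⁻¹' {word L v}) with ha
  set h := densLim * Real.log 2 with hdef
  have key : ∀ r, t * a ≤ (L + 1) * |dens r * Real.log 2 - h| +
      (Real.exp t - 1) * avg r fun A => wt A L v := by
    intro r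
    set P : ℝ := (per r : ℝ) with hP
    have hP1 : 1 ≤ P := Nat.one_le_cast.2 (per_pos r)
    set b := avg r fun A => wt A L v with hb
    have h1 : ∀ ε > 0, P * (P * L + 1) * (h - ε) + t * (P * P * a) ≤
        P * (P * L + 1) * dens r * Real.log 2 + (Real.exp t - 1) * (P * P * b) := by
      intro ε hε
      obtain ⟨K, hK⟩ := exists_le_partH_word hν hh hε
      have h2 : ∀ n : ℕ, P * (P * L + 1) * (h - ε) + t * (P * P * a) ≤
          (K + Real.log P) * (1 / ((n : ℝ) + 1)) +
          (P * (P * L + 1) * dens r * Real.log 2 + (Real.exp t - 1) * (P * P * b)) := by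
        intro n
        have hn : (0 : ℝ) < n + 1 := by positivity
        have h3 := hK ((n + 1) * per r * (per r * L + 1))
        have h4 := partH_word_add_le hν hX v L r (n + 1) t
        push_cast at h3 h4
        rw [← hP, ← ha] at h4
        rw [← hP] at h3
        rw [one_div, ← div_eq_mul_inv, ← sub_le_iff_le_add, le_div_iff₀ hn]
        linarith
      have h5 := (tendsto_one_div_add_atTop_nhds_zero_nat (𝕜 := ℝ)).const_mul
        (K + Real.log P) |>.add_const
          (P * (P * L + 1) * dens r * Real.log 2 + (Real.exp t - 1) * (P * P * b))
      rw [mul_zero, zero_add] at h5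
      exact ge_of_tendsto' h5 h2
    have h6 : P * (P * L + 1) * h + t * (P * P * a) ≤
        P * (P * L + 1) * dens r * Real.log 2 + (Real.exp t - 1) * (P * P * b) := by
      refine le_of_forall_pos_le_add fun δ hδ => ?_
      have hM : 0 < P * (P * L + 1) := by positivity
      have := h1 (δ / (P * (P * L + 1))) (by positivity)
      rw [mul_sub, mul_div_cancel₀ _ hM.ne'] at this
      linarith
    have h7 : P * (P * L + 1) * (dens r * Real.log 2 - h) ≤
        P * P * ((L + 1) * |dens r * Real.log 2 - h|) := by
      have h8 : P * (P * L + 1) ≤ P * P * (L + 1) := by nlinarith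
      calc P * (P * L + 1) * (dens r * Real.log 2 - h)
          ≤ P * (P * L + 1) * |dens r * Real.log 2 - h| :=
            mul_le_mul_of_nonneg_left (le_abs_self _) (by positivity)
        _ ≤ P * P * (L + 1) * |dens r * Real.log 2 - h| :=
            mul_le_mul_of_nonneg_right h8 (abs_nonneg _)
        _ = _ := by ring
    have h9 : P * P * (t * a) ≤ P * P * ((L + 1) * |dens r * Real.log 2 - h| +
        (Real.exp t - 1) * b) := by linarith
    exact le_of_mul_le_mul_left h9 (by positivity)
  have hlim : Tendsto (fun r => (L + 1) * |dens r * Real.log 2 - h| +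
      (Real.exp t - 1) * avg r fun A => wt A L v) atTop
      (nhds ((L + 1) * |h - h| + (Real.exp t - 1) * mme.real (word L ⁻¹' {word L v}))) :=
    ((((tendsto_dens.mul_const _).sub_const h).abs).const_mul _).add
      ((tendsto_avg_wt v L).const_mul _)
  rw [sub_self, abs_zero, mul_zero, zero_add] at hlim
  exact ge_of_tendsto' hlim key

lemma cylinder_le {ν : Measure Omega2} [IsProbabilityMeasure ν]
    (hν : MeasurePreserving shift ν ν) (hX : ∀ᵐ x ∂ν, x ∈ SqfFlow)
    (hh : ksEntropy ν shift = ((densLim * Real.log 2 : ℝ) : EReal)) (v : Omega2) (L : ℕ) :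
    ν.real (word L ⁻¹' {word L v}) ≤ mme.real (word L ⁻¹' {word L v}) := by
  set b := mme.real (word L ⁻¹' {word L v}) with hb
  have hb0 : 0 ≤ b := measureReal_nonneg
  have h1 : ∀ n : ℕ, ν.real (word L ⁻¹' {word L v}) ≤ b + 1 / ((n : ℝ) + 1) * b := by
    intro n
    have ht : 0 < 1 / ((n : ℝ) + 1) := by positivity
    have ht1 : 1 / ((n : ℝ) + 1) ≤ 1 := (div_le_one (by positivity)).2 (by simp)
    have h2 := mul_cylinder_le hν hX hh v L (1 / ((n : ℝ) + 1))
    set t := 1 / ((n : ℝ) + 1) with htdef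
    have h3 := (abs_le.1 (Real.abs_exp_sub_one_sub_id_le (by rwa [abs_of_pos ht]))).2
    refine le_of_mul_le_mul_left (h2.trans ?_) ht
    calc (Real.exp t - 1) * b ≤ (t + t ^ 2) * b :=
          mul_le_mul_of_nonneg_right (by linarith) hb0
      _ = t * (b + t * b) := by ring
  have h5 := ((tendsto_one_div_add_atTop_nhds_zero_nat (𝕜 := ℝ)).mul_const b).const_add b
  rw [zero_mul, add_zero] at h5
  exact ge_of_tendsto' h5 h1

lemma sum_measureReal_word (ν : Measure Omega2) [IsProbabilityMeasure ν] (L : ℕ) :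
    ∑ w : Fin L → Bool, ν.real (word L ⁻¹' {w}) = 1 := by
  have := integral_comp_of_finite ν (measurable_word L) fun _ => (1 : ℝ)
  simpa using this.symm

lemma eq_mme {ν : Measure Omega2} [IsProbabilityMeasure ν]
    (hν : MeasurePreserving shift ν ν) (hX : ∀ᵐ x ∂ν, x ∈ SqfFlow)
    (hh : ksEntropy ν shift = ((densLim * Real.log 2 : ℝ) : EReal)) : ν = mme := by
  have h1 : ∀ L, ν.map (word L) = mme.map (word L) := by
    intro L
    have hle : ∀ w ∈ Finset.univ, ν.real (word L ⁻¹' {w}) ≤ mme.real (word L ⁻¹' {w}) := by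
      intro w _
      have hw : w = word L (extend0 w) := funext fun i => (extend0_apply w i).symm
      rw [hw]
      exact cylinder_le hν hX hh _ L
    have heq := (Finset.sum_eq_sum_iff_of_le hle).1
      ((sum_measureReal_word ν L).trans (sum_measureReal_word mme L).symm)
    refine Measure.ext_of_singleton fun w => ?_
    rw [Measure.map_apply (measurable_word L) (MeasurableSet.singleton _),
      Measure.map_apply (measurable_word L) (MeasurableSet.singleton _)]
    exact (measureReal_eq_measureReal_iff).1 (heq w (Finset.mem_univ _))
  refine ext_of_generate_finite cylAlg generateFrom_cylAlg
    (fun A hA B hB _ => isSetAlgebra_cylAlg.inter_mem hA hB) ?_ (by simp)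
  rintro _ ⟨L, S, rfl⟩
  have hS : MeasurableSet S := (Set.toFinite S).measurableSet
  rw [← Measure.map_apply (measurable_word L) hS, h1, Measure.map_apply (measurable_word L) hS]

open Dynamics in
/-- The squarefree flow `(X, σ)` possesses a unique measure of maximal
entropy: there is exactly one shift-invariant Borel probability measure on `X` whose
measure-theoretic (Kolmogorov–Sinai) entropy equals the topological entropy of `(X, σ)`. -/
theorem squarefree_flow_unique_mme :
    ∃! ν : Measure Omega2, IsProbabilityMeasure ν ∧ MeasurePreserving shift ν ν ∧
      ν SqfFlow = 1 ∧ ksEntropy ν shift = coverEntropy shift SqfFlow := by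
  rw [coverEntropy_SqfFlow]
  refine ⟨mme, ⟨inferInstance, measurePreserving_shift_mme, mme_SqfFlow, ksEntropy_mme⟩, ?_⟩
  rintro ν ⟨hprob, hν, hX, hh⟩
  exact eq_mme hν (ae_mem_SqfFlow hX) hh

end
end

section
/- Let p_1 < p_2 < ⋯ < p_r be the first r primes, let I = (i_1, …, i_r) with 1 ≤ i_k ≤ p_k² − 1 for each k, and let u^I_L denote the number of distinct words of length L occurring in elements of X_I(r). Then for every m ≥ 1, with L = m·p_1²p_2²⋯p_r², one has 2^{m·∏_{k=1}^r (p_k² − i_k)} ≤ u^I_L ≤ (∏_{k=1}^r C(p_k², i_k)) · 2^{m·∏_{k=1}^r (p_k² − i_k)}, where C(n,i) denotes the binomial coefficient. -/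
open MeasureTheory Filter Set
open scoped ENNReal Classical

noncomputable section

section Words

variable {ι : Type*} [Fintype ι] {q : ι → ℕ}

theorem prodEquivPi_natCast (hc : Pairwise (Function.onFun Nat.Coprime q)) (n : ℕ) (i : ι) :
    ZMod.prodEquivPi q hc n i = n := by
  rw [map_natCast, Pi.natCast_apply]

theorem exists_natCast_eq_pi (hq : ∀ i, q i ≠ 0) (hc : Pairwise (Function.onFun Nat.Coprime q))
    (N : ℕ) (a : ∀ i, ZMod (q i)) : ∃ n, N ≤ n ∧ ∀ i, (n : ZMod (q i)) = a i := by
  have hQ : ∏ i, q i ≠ 0 := Finset.prod_ne_zero_iff.mpr fun i _ => hq i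
  have : NeZero (∏ i, q i) := ⟨hQ⟩
  obtain ⟨b, rfl⟩ := (ZMod.prodEquivPi q hc).surjective a
  refine ⟨b.val + (∏ i, q i) * N, ?_, fun i => ?_⟩
  · exact (Nat.le_mul_of_pos_left N (Nat.pos_of_ne_zero hQ)).trans (Nat.le_add_left _ _)
  · have h0 : ((∏ i, q i : ℕ) : ZMod (q i)) = 0 :=
      (ZMod.natCast_eq_zero_iff _ _).mpr (Finset.dvd_prod_of_mem q (Finset.mem_univ i))
    rw [Nat.cast_add, Nat.cast_mul, h0, zero_mul, add_zero,
      ← prodEquivPi_natCast hc, ZMod.natCast_zmod_val]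

/-- The positions `t < L` whose residue modulo `q i` avoids `B i` for every `i`. -/
def freePositions (L : ℕ) (B : ∀ i, Finset (ZMod (q i))) : Finset (Fin L) :=
  Finset.univ.filter fun t => ∀ i, ((t : ℕ) : ZMod (q i)) ∉ B i

theorem mem_freePositions {L : ℕ} {B : ∀ i, Finset (ZMod (q i))} {t : Fin L} :
    t ∈ freePositions L B ↔ ∀ i, ((t : ℕ) : ZMod (q i)) ∉ B i := by
  simp [freePositions]

theorem card_freePositions [∀ i, NeZero (q i)] (hc : Pairwise (Function.onFun Nat.Coprime q))
    (m : ℕ) (B : ∀ i, Finset (ZMod (q i))) :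
    (freePositions (m * ∏ i, q i) B).card = m * ∏ i, (q i - (B i).card) := by
  have : NeZero (∏ i, q i) := ⟨Finset.prod_ne_zero_iff.mpr fun i _ => NeZero.ne (q i)⟩
  let f : ZMod (∏ i, q i) ≃ Fin (∏ i, q i) :=
    { toFun := fun b => ⟨b.val, b.val_lt⟩
      invFun := fun c => ((c : ℕ) : ZMod (∏ i, q i))
      left_inv := fun b => ZMod.natCast_zmod_val b
      right_inv := fun c => Fin.ext (ZMod.val_cast_of_lt c.2) }
  let e : Fin m × (∀ i, ZMod (q i)) ≃ Fin (m * ∏ i, q i) :=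
    ((Equiv.refl _).prodCongr ((ZMod.prodEquivPi q hc).symm.toEquiv.trans f)).trans finProdFinEquiv
  have he : ∀ x i, (((e x : Fin _) : ℕ) : ZMod (q i)) = x.2 i := by
    rintro ⟨y, a⟩ i
    obtain ⟨b, rfl⟩ := (ZMod.prodEquivPi q hc).surjective a
    have h0 : ((∏ i, q i : ℕ) : ZMod (q i)) = 0 :=
      (ZMod.natCast_eq_zero_iff _ _).mpr (Finset.dvd_prod_of_mem q (Finset.mem_univ i))
    have hval : ((e (y, ZMod.prodEquivPi q hc b) : Fin _) : ℕ) = b.val + (∏ i, q i) * y := by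
      simp [e, f]
    rw [hval, Nat.cast_add, Nat.cast_mul, h0, zero_mul, add_zero, ← prodEquivPi_natCast hc,
      ZMod.natCast_zmod_val]
  have hcard : (Finset.univ ×ˢ Fintype.piFinset fun i => (B i)ᶜ :
      Finset (Fin m × ∀ i, ZMod (q i))).card = (freePositions (m * ∏ i, q i) B).card :=
    Finset.card_equiv e fun x => by simp [mem_freePositions, he]
  rw [← hcard, Finset.card_product, Fintype.card_piFinset]
  simp [Finset.card_compl, ZMod.card]

/-- The words vanishing outside `S`. -/
def wordsOn {L : ℕ} (S : Finset (Fin L)) : Finset (Fin L → Bool) :=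
  S.powerset.image fun T t => decide (t ∈ T)

theorem mem_wordsOn {L : ℕ} {S : Finset (Fin L)} {w : Fin L → Bool} :
    w ∈ wordsOn S ↔ ∀ t, w t = true → t ∈ S := by
  simp only [wordsOn, Finset.mem_image, Finset.mem_powerset]
  constructor
  · rintro ⟨T, hT, rfl⟩ t ht
    exact hT (by simpa using ht)
  · intro h
    refine ⟨Finset.univ.filter fun t => w t = true, fun t ht => h t (by simpa using ht), ?_⟩
    funext t
    simp

theorem card_wordsOn {L : ℕ} (S : Finset (Fin L)) : (wordsOn S).card = 2 ^ S.card := by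
  rw [wordsOn, Finset.card_image_of_injective, Finset.card_powerset]
  intro T T' h
  ext t
  simpa using congrFun h t

/-- The sequences omitting exactly `I i` residue classes modulo `q i` for every `i`. -/
def exactOmit (q I : ι → ℕ) : Set Omega2 := {x | ∀ i, numOmitted x (q i) = I i}

theorem wordsOn_subset_words [∀ i, NeZero (q i)] (hc : Pairwise (Function.onFun Nat.Coprime q))
    {I : ι → ℕ} {B : ∀ i, Finset (ZMod (q i))} (hB : ∀ i, (B i).card = I i)
    (hlt : ∀ i, I i < q i) (L : ℕ) {w : Fin L → Bool} (hw : w ∈ wordsOn (freePositions L B)) :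
    ∃ x ∈ exactOmit q I, ∃ j : ℕ, ∀ t : Fin L, w t = x (j + (t : ℕ)) := by
  rw [mem_wordsOn] at hw
  let x : Omega2 := fun n => if h : n < L then w ⟨n, h⟩ else decide (∀ i, (n : ZMod (q i)) ∉ B i)
  have hne : ∀ i, ∃ a, a ∉ B i := by
    intro i
    by_contra! h
    have : B i = Finset.univ := Finset.eq_univ_of_forall h
    have h1 := hB i
    rw [this, Finset.card_univ, ZMod.card] at h1
    exact (hlt i).ne' h1
  choose c hcB using hne
  refine ⟨x, fun i => ?_, 0, fun t => by simp [x]⟩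
  have hset : {a : ZMod (q i) | OmitsMod x (q i) a} = ((B i).image (· + 1) : Finset _) := by
    ext a
    simp only [Set.mem_ofPred_eq, Finset.coe_image, Set.mem_image, Finset.mem_coe]
    constructor
    · intro ha
      by_contra hna
      have ha' : a - 1 ∉ B i := fun h => hna ⟨_, h, by ring⟩
      obtain ⟨n, hn, hna⟩ := exists_natCast_eq_pi (fun i => NeZero.ne (q i)) hc L
        (Function.update c i (a - 1))
      have h1 := ha n (by rw [Nat.cast_add, hna i]; simp)
      simp only [x, dif_neg (not_lt.mpr hn), decide_eq_false_iff_not] at h1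
      apply h1
      intro k
      rw [hna k]
      by_cases hk : k = i
      · subst hk; simpa using ha'
      · simpa [hk] using hcB k
    · rintro ⟨b, hb, rfl⟩ n hn
      have hn' : (n : ZMod (q i)) = b := by
        rw [Nat.cast_add, Nat.cast_one] at hn
        exact add_right_cancel hn
      by_cases hnL : n < L
      · by_contra hx
        have hx : w ⟨n, hnL⟩ = true := by simpa [x, hnL] using hx
        exact mem_freePositions.mp (hw _ hx) i (by simpa [hn'] using hb)
      · simp only [x, dif_neg hnL, decide_eq_false_iff_not]
        exact fun h => h i (hn' ▸ hb)
  rw [numOmitted, hset, Set.ncard_coe_finset,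
    Finset.card_image_of_injective _ (add_left_injective 1), hB]

theorem words_subset_biUnion [∀ i, NeZero (q i)] {I : ι → ℕ} {L : ℕ} {w : Fin L → Bool}
    (hw : ∃ x ∈ exactOmit q I, ∃ j : ℕ, ∀ t : Fin L, w t = x (j + (t : ℕ))) :
    w ∈ (Fintype.piFinset fun i => Finset.powersetCard (I i) (Finset.univ : Finset (ZMod (q i)))
      ).biUnion fun B => wordsOn (freePositions L B) := by
  obtain ⟨x, hx, j, hj⟩ := hw
  let A : ∀ i, Finset (ZMod (q i)) := fun i => Finset.univ.filter (OmitsMod x (q i))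
  have hA : ∀ i, (A i).card = I i := by
    intro i
    rw [← hx i, numOmitted, ← Set.ncard_coe_finset]
    simp [A]
  rw [Finset.mem_biUnion]
  refine ⟨fun i => (A i).image (· - (j + 1)), ?_, ?_⟩
  · simp only [Fintype.mem_piFinset, Finset.mem_powersetCard, Finset.subset_univ, true_and]
    intro i
    rw [Finset.card_image_of_injective _ sub_left_injective, hA]
  · rw [mem_wordsOn]
    intro t ht
    rw [mem_freePositions]
    intro i hi
    obtain ⟨a, ha, hat⟩ := Finset.mem_image.mp hi
    have hom : OmitsMod x (q i) a := by simpa [A] using ha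
    have := hom (j + t) (by push_cast; rw [← hat]; ring)
    rw [hj t, this] at ht
    exact Bool.false_ne_true ht

theorem wordCount_exactOmit_bounds [∀ i, NeZero (q i)]
    (hc : Pairwise (Function.onFun Nat.Coprime q)) {I : ι → ℕ} (hlt : ∀ i, I i < q i) (m : ℕ) :
    2 ^ (m * ∏ i, (q i - I i)) ≤ wordCount (exactOmit q I) (m * ∏ i, q i) ∧
    wordCount (exactOmit q I) (m * ∏ i, q i) ≤
      (∏ i, Nat.choose (q i) (I i)) * 2 ^ (m * ∏ i, (q i - I i)) := by
  have hcard : ∀ B : ∀ i, Finset (ZMod (q i)), (∀ i, (B i).card = I i) →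
      (wordsOn (freePositions (m * ∏ i, q i) B)).card = 2 ^ (m * ∏ i, (q i - I i)) := by
    intro B hB
    simp only [card_wordsOn, card_freePositions hc, hB]
  constructor
  · have hex : ∀ i, ∃ B : Finset (ZMod (q i)), B.card = I i := fun i => by
      obtain ⟨B, -, hB⟩ := Finset.exists_subset_card_eq
        (s := (Finset.univ : Finset (ZMod (q i)))) (n := I i)
        (by rw [Finset.card_univ, ZMod.card]; exact (hlt i).le)
      exact ⟨B, hB⟩
    choose B hB using hex
    rw [← hcard B hB, ← Set.ncard_coe_finset]
    exact Set.ncard_le_ncard (fun w hw => wordsOn_subset_words hc hB hlt _ hw) (Set.toFinite _)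
  · refine (Set.ncard_le_ncard (fun w hw => Finset.mem_coe.mpr (words_subset_biUnion hw))
      (Set.toFinite _)).trans ?_
    rw [Set.ncard_coe_finset]
    refine (Finset.card_biUnion_le_card_mul _ _ (2 ^ (m * ∏ i, (q i - I i))) ?_).trans ?_
    · intro B hB
      simp only [Fintype.mem_piFinset, Finset.mem_powersetCard] at hB
      exact (hcard B fun i => (hB i).2).le
    · rw [Fintype.card_piFinset]
      simp [Finset.card_powersetCard, ZMod.card]

end Words

theorem XIr_eq_exactOmit {r : ℕ} {I : Fin r → ℕ} (hI : ∀ k, 1 ≤ I k) :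
    XIr r I = exactOmit (fun k : Fin r => (nthPrime k : ℕ) ^ 2) I := by
  ext x
  refine ⟨fun hx => hx.2, fun hx => ⟨fun k => ?_, hx⟩⟩
  exact Set.nonempty_of_ncard_ne_zero (s := {a | OmitsMod x ((nthPrime k : ℕ) ^ 2) a})
    (Nat.one_le_iff_ne_zero.mp ((hI k).trans_eq (hx k).symm))

theorem pairwise_coprime_nthPrime_sq (r : ℕ) :
    Pairwise (Function.onFun Nat.Coprime fun k : Fin r => (nthPrime k : ℕ) ^ 2) := by
  intro k l hkl
  refine Nat.Coprime.pow 2 2 ((Nat.coprime_primes (nthPrime k).2 (nthPrime l).2).mpr fun h => ?_)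
  exact hkl (Fin.ext (Nat.nth_injective Nat.infinite_setOfPred_prime h))

/-- Word-count bounds for `X_I(r)`: with `p_1 < ⋯ < p_r` the first `r`
primes, `1 ≤ i_k ≤ p_k² − 1`, `m ≥ 1` and `L = m·p_1²⋯p_r²`,
`2^{m·∏(p_k² − i_k)} ≤ u^I_L ≤ (∏ C(p_k², i_k)) · 2^{m·∏(p_k² − i_k)}`. -/
theorem word_count_bounds (r : ℕ) (hr : 1 ≤ r) (I : Fin r → ℕ)
    (hI : ∀ k : Fin r, 1 ≤ I k ∧ I k ≤ (nthPrime k : ℕ) ^ 2 - 1) (m : ℕ) (hm : 1 ≤ m) :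
    2 ^ (m * ∏ k : Fin r, ((nthPrime k : ℕ) ^ 2 - I k)) ≤
        wordCount (XIr r I) (m * ∏ k : Fin r, (nthPrime k : ℕ) ^ 2) ∧
    wordCount (XIr r I) (m * ∏ k : Fin r, (nthPrime k : ℕ) ^ 2) ≤
      (∏ k : Fin r, Nat.choose ((nthPrime k : ℕ) ^ 2) (I k)) *
        2 ^ (m * ∏ k : Fin r, ((nthPrime k : ℕ) ^ 2 - I k)) := by
  rw [XIr_eq_exactOmit fun k => (hI k).1]
  refine wordCount_exactOmit_bounds (pairwise_coprime_nthPrime_sq r) (fun k => ?_) m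
  have := pow_pos (nthPrime k).2.pos 2
  have := (hI k).2
  omega

end
end

section
/- The insertion map ι : G × Ω⁽²⁾ → X is surjective, Borel measurable, and satisfies ι ∘ T = σ ∘ ι, where T is the skew-product transformation T(g, y) = (T₁g, σ^{ψ(g)} y) with ψ(g) = 0 if g ∈ G₁ and ψ(g) = 1 otherwise. -/
open MeasureTheory Filter Set
open scoped ENNReal Classical

noncomputable section

/-- The index `n` (position `n + 1`) receives an inserted zero. -/
def Inserted (g : G) (n : ℕ) : Prop :=
  ∃ p : Nat.Primes, ((n + 1 : ℕ) : ZMod ((p : ℕ) ^ 2)) = g p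

lemma alphaG_eq_count (g : G) (m : ℕ) : alphaG g m = Nat.count (Inserted g) m := by
  have h : {n : ℕ | 1 ≤ n ∧ n ≤ m ∧ ∃ p : Nat.Primes, ((n : ℕ) : ZMod ((p : ℕ) ^ 2)) = g p} =
      Nat.succ '' ((Finset.range m).filter (Inserted g) : Finset ℕ) := by
    ext n
    simp only [Set.mem_ofPred_eq, Set.mem_image, Finset.coe_filter, Finset.mem_range]
    constructor
    · rintro ⟨h1, hm, h⟩
      obtain ⟨k, rfl⟩ : ∃ k, n = k + 1 := ⟨n - 1, by omega⟩
      exact ⟨k, ⟨by omega, h⟩, rfl⟩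
    · rintro ⟨k, ⟨hk, h⟩, rfl⟩
      exact ⟨by omega, by omega, h⟩
  rw [alphaG, h, Set.ncard_image_of_injective _ Nat.succ_injective, Set.ncard_coe_finset,
    Nat.count_eq_card_filter_range]

lemma count_add_count_not (P : ℕ → Prop) (n : ℕ) :
    Nat.count P n + Nat.count (fun k => ¬ P k) n = n := by
  induction n with
  | zero => simp
  | succ n ih =>
    rw [Nat.count_succ, Nat.count_succ]
    by_cases h : P n <;> simp [h] <;> omega

lemma iota_apply (g : G) (y : Omega2) (n : ℕ) :
    iota g y n = if Inserted g n then false else y (Nat.count (fun k => ¬ Inserted g k) n) := by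
  change (if Inserted g n then false else y (n - alphaG g (n + 1))) = _
  by_cases h : Inserted g n
  · rw [if_pos h, if_pos h]
  · rw [if_neg h, if_neg h, alphaG_eq_count, Nat.count_succ, if_neg h]
    have := count_add_count_not (Inserted g) n
    congr 1
    omega

lemma inserted_T1 (g : G) (n : ℕ) : Inserted (T1 g) n ↔ Inserted g (n + 1) := by
  unfold Inserted T1
  refine exists_congr fun p => ?_
  rw [eq_sub_iff_add_eq]
  push_cast
  rfl

lemma inserted_zero (g : G) : Inserted g 0 ↔ g ∈ G1 := by
  simp [Inserted, G1, eq_comm]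

lemma iota_mem_SqfFlow (g : G) (y : Omega2) : iota g y ∈ SqfFlow := fun p =>
  ⟨g p, fun _ hn => if_pos ⟨p, hn⟩⟩

lemma exists_iota_eq {x : Omega2} (hx : x ∈ SqfFlow) : ∃ g y, iota g y = x := by
  choose g hg using hx
  refine ⟨g, fun k => x (Nat.nth (fun j => ¬ Inserted g j) k), funext fun n => ?_⟩
  rw [iota_apply]
  split_ifs with h
  · obtain ⟨p, hp⟩ := h
    exact (hg p n hp).symm
  · rw [Nat.nth_count (p := fun j => ¬ Inserted g j) h]

lemma measurableSet_inserted (n : ℕ) : MeasurableSet {g : G | Inserted g n} := by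
  simp only [Inserted, Set.ofPred_exists]
  refine MeasurableSet.iUnion fun p => ?_
  have h : MeasurableSet {a : ZMod ((p : ℕ) ^ 2) | ((n + 1 : ℕ) : ZMod ((p : ℕ) ^ 2)) = a} :=
    MeasurableSpace.measurableSet_top
  exact measurable_pi_apply p h

lemma measurable_count_not_inserted (n : ℕ) :
    Measurable fun g : G => Nat.count (fun k => ¬ Inserted g k) n := by
  induction n with
  | zero => simp
  | succ n ih =>
    simp only [Nat.count_succ]
    exact ih.add (Measurable.ite (measurableSet_inserted n).compl measurable_const measurable_const)

lemma measurable_iota : Measurable fun gy : G × Omega2 => iota gy.1 gy.2 := by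
  refine measurable_pi_lambda _ fun n => ?_
  simp only [iota_apply]
  have heval : Measurable fun q : ℕ × Omega2 => q.2 q.1 :=
    measurable_from_prod_countable_right fun k => measurable_pi_apply k
  exact Measurable.ite (measurable_fst (measurableSet_inserted n)) measurable_const
    (heval.comp (((measurable_count_not_inserted n).comp measurable_fst).prodMk measurable_snd))

lemma iota_skewT (gy : G × Omega2) : iota (skewT gy).1 (skewT gy).2 = shift (iota gy.1 gy.2) := by
  obtain ⟨g, y⟩ := gy
  funext n
  by_cases h : g ∈ G1
  · simp [skewT, shift, iota_apply, inserted_T1, Nat.count_succ', inserted_zero, h]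
  · simp [skewT, shift, iota_apply, inserted_T1, Nat.count_succ', inserted_zero, h]

/-- The insertion map `ι : G × Ω⁽²⁾ → X` is surjective onto the
squarefree flow `X`, Borel measurable, and satisfies `ι ∘ T = σ ∘ ι`, where `T` is the
skew product `T(g, y) = (T₁ g, σ^{ψ(g)} y)` with `ψ = 1 − 1_{G₁}`. -/
theorem insertion_map_properties :
    Set.range (fun gy : G × Omega2 => iota gy.1 gy.2) = SqfFlow ∧
    Measurable (fun gy : G × Omega2 => iota gy.1 gy.2) ∧
    ∀ gy : G × Omega2, iota (skewT gy).1 (skewT gy).2 = shift (iota gy.1 gy.2) := by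
  refine ⟨Set.Subset.antisymm ?_ fun x hx => ?_, measurable_iota, iota_skewT⟩
  · rintro _ ⟨gy, rfl⟩
    exact iota_mem_SqfFlow gy.1 gy.2
  · obtain ⟨g, y, h⟩ := exists_iota_eq hx
    exact ⟨(g, y), h⟩

end
end

section
/- The map ρ : X₁ → G sending x to the sequence g_x, where (g_x)_p is the unique residue class modulo p² omitted by supp(x), is Borel measurable and satisfies ρ ∘ σ = T₁ ∘ ρ on X₁. -/
open MeasureTheory Filter Set
open scoped ENNReal Classical

noncomputable section

theorem measurableSet_omitsMod (q : ℕ) (a : ZMod q) :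
    MeasurableSet {x : Omega2 | OmitsMod x q a} := by
  have h : {x : Omega2 | OmitsMod x q a} =
      ⋂ n : ℕ, ⋂ _ : ((n + 1 : ℕ) : ZMod q) = a, (fun x : Omega2 => x n) ⁻¹' {false} := by
    ext x
    simp [OmitsMod]
  rw [h]
  exact MeasurableSet.iInter fun n => MeasurableSet.iInter fun _ =>
    measurable_pi_apply n (measurableSet_singleton false)

theorem omitsMod_rho {x : Omega2} (hx : x ∈ X1) (p : Nat.Primes) :
    OmitsMod x ((p : ℕ) ^ 2) (rho x p) := by
  have h := hx.1 p
  rw [rho, dif_pos h]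
  exact h.choose_spec

theorem omitsMod_iff_rho_eq {x : Omega2} (hx : x ∈ X1) (p : Nat.Primes)
    (a : ZMod ((p : ℕ) ^ 2)) : OmitsMod x ((p : ℕ) ^ 2) a ↔ rho x p = a := by
  refine ⟨fun h => ?_, fun h => h ▸ omitsMod_rho hx p⟩
  obtain ⟨b, hb⟩ := Set.ncard_eq_one.mp (hx.2.1 p)
  have h₁ : rho x p ∈ ({b} : Set _) := hb ▸ omitsMod_rho hx p
  have h₂ : a ∈ ({b} : Set _) := hb ▸ h
  exact h₁.trans h₂.symm

theorem OmitsMod.shift {x : Omega2} {q : ℕ} {a : ZMod q} (h : OmitsMod x q a) :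
    OmitsMod (shift x) q (a - 1) := fun n hn => h (n + 1) <| by
  rw [Nat.cast_succ, hn, sub_add_cancel]

/-- Persistence rules out that the first position is the only one of the support in its class. -/
theorem Persistent.omitsMod_of_shift {x : Omega2} {q : ℕ} (hx : Persistent x q) {a : ZMod q}
    (h : OmitsMod (shift x) q a) : OmitsMod x q (a + 1) := by
  intro n hn
  by_contra hxn
  obtain ⟨m, ⟨hm, hxm⟩, hm₀⟩ :=
    (hx (a + 1) ⟨n, hn, by simpa using hxn⟩).exists_gt 0
  obtain ⟨k, rfl⟩ := Nat.exists_eq_succ_of_ne_zero hm₀.ne'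
  have hk : x (k + 1) = false := h k <| by
    rw [Nat.succ_eq_add_one, Nat.cast_succ (k + 1)] at hm
    exact add_right_cancel hm
  exact absurd (hxm.symm.trans hk) (by decide)

theorem measurable_rho_X1 : Measurable (fun x : ↥X1 => rho (x : Omega2)) := by
  refine measurable_pi_iff.mpr fun p => measurable_to_countable' fun a => ?_
  have h : (fun x : ↥X1 => rho (x : Omega2) p) ⁻¹' {a} =
      Subtype.val ⁻¹' {x : Omega2 | OmitsMod x ((p : ℕ) ^ 2) a} := by
    ext x
    exact (omitsMod_iff_rho_eq x.2 p a).symm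
  rw [h]
  exact measurable_subtype_coe (measurableSet_omitsMod _ a)

theorem rho_shift {x : Omega2} (hx : x ∈ X1) : rho (shift x) = T1 (rho x) := by
  funext p
  have hex : ∃ a : ZMod ((p : ℕ) ^ 2), OmitsMod (shift x) ((p : ℕ) ^ 2) a :=
    ⟨_, (omitsMod_rho hx p).shift⟩
  have hspec : OmitsMod (shift x) ((p : ℕ) ^ 2) (rho (shift x) p) := by
    rw [rho, dif_pos hex]
    exact hex.choose_spec
  have h := (omitsMod_iff_rho_eq hx p _).mp ((hx.2.2 p).omitsMod_of_shift hspec)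
  exact eq_sub_of_add_eq h.symm

/-- The map `ρ : X₁ → G`, sending `x` to the sequence of residue classes
omitted by `supp(x)` modulo the `p²`, is Borel measurable and satisfies
`ρ ∘ σ = T₁ ∘ ρ` on `X₁`. -/
theorem rho_measurable_equivariant :
    Measurable (fun x : ↥X1 => rho (x : Omega2)) ∧
    ∀ x ∈ X1, rho (shift x) = T1 (rho x) :=
  ⟨measurable_rho_X1, fun _ hx => rho_shift hx⟩

end
end
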